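/- Let (R, 𝔪) be a Cohen-Macaulay Noetherian local ring of Krull dimension d ≥ 2 with a canonical module ω_R. Let M be a finitely generated R-module such that Ass_R(M) ⊆ Ass_R(R) ∪ {𝔪} and M satisfies Serre's condition (S₂) on the punctured spectrum. Let φ : M → M^{∨∨} = Hom_R(Hom_R(M, ω_R), ω_R) be the natural evaluation map. Then coker(φ) ≅ H^1_𝔪(M); thus there is an exact sequence 0 → Γ_𝔪(M) → M →φ M^{∨∨} → H^1_𝔪(M) → 0. -/

import Mathlib

open CategoryTheory Opposite IsLocalRing

/-- The Ext module `Ext^i_R(M, N)` as an object of `ModuleCat R`. -/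
noncomputable def extMod (R : Type) [CommRing R] (M N : Type) [AddCommGroup M] [Module R M]
    [AddCommGroup N] [Module R N] (i : ℕ) : ModuleCat R :=
  ((Ext R (ModuleCat R) i).obj (op (ModuleCat.of R M))).obj (ModuleCat.of R N)

/-- The Tor module `Tor_i^R(M, N)` as an object of `ModuleCat R`. -/
noncomputable def torMod (R : Type) [CommRing R] (M N : Type) [AddCommGroup M] [Module R M]
    [AddCommGroup N] [Module R N] (i : ℕ) : ModuleCat R :=
  ((Tor (ModuleCat R) i).obj (ModuleCat.of R M)).obj (ModuleCat.of R N)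

/-- The depth of a module over a Noetherian local ring: the least `i` such that
`Ext^i_R(k, M) ≠ 0`, with the convention `depth 0 = ⊤` (as `sInf ∅ = ⊤` in `ℕ∞`). -/
noncomputable def rdepth (R : Type) [CommRing R] [IsLocalRing R] (M : Type) [AddCommGroup M]
    [Module R M] : ℕ∞ :=
  sInf {n : ℕ∞ | ∃ i : ℕ, Nontrivial (extMod R (ResidueField R) M i) ∧ n = i}

/-- The Krull dimension of a module: `dim R⧸Ann M`. -/
noncomputable def mdim (R : Type) [CommRing R] (M : Type) [AddCommGroup M] [Module R M] :
    WithBot ℕ∞ :=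
  ringKrullDim (R ⧸ Module.annihilator R M)

/-- `M` is Cohen-Macaulay of dimension `n`: depth and dimension both equal `n`. -/
def isCMofDim (R : Type) [CommRing R] [IsLocalRing R] (M : Type) [AddCommGroup M] [Module R M]
    (n : ℕ) : Prop :=
  rdepth R M = (n : ℕ∞) ∧ mdim R M = (n : ℕ)

/-- `M` is Cohen-Macaulay: depth equals dimension. -/
def isCM (R : Type) [CommRing R] [IsLocalRing R] (M : Type) [AddCommGroup M] [Module R M] : Prop :=
  (rdepth R M : WithBot ℕ∞) = mdim R M

/-- `R` is a Cohen-Macaulay local ring of dimension `d`. -/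
def isCMLocalRing (R : Type) [CommRing R] [IsLocalRing R] (d : ℕ) : Prop :=
  ringKrullDim R = (d : ℕ) ∧ rdepth R R = (d : ℕ∞)

/-- `M` has Sliding Depth of Extension modules: for `1 ≤ i ≤ d-1`, either `Ext^i(M,R) = 0`
or `depth Ext^i(M,R) ≥ d - i`. -/
def isSDE (R : Type) [CommRing R] [IsLocalRing R] (M : Type) [AddCommGroup M] [Module R M]
    (d : ℕ) : Prop :=
  ∀ i : ℕ, 1 ≤ i → i ≤ d - 1 →
    Subsingleton (extMod R M R i) ∨ ((d - i : ℕ) : ℕ∞) ≤ rdepth R (extMod R M R i)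

/-- `M` has Cohen-Macaulay Extension modules: for `1 ≤ i ≤ d-1`, either `Ext^i(M,R) = 0`
or `Ext^i(M,R)` is Cohen-Macaulay of dimension `d - i`. -/
def isCME (R : Type) [CommRing R] [IsLocalRing R] (M : Type) [AddCommGroup M] [Module R M]
    (d : ℕ) : Prop :=
  ∀ i : ℕ, 1 ≤ i → i ≤ d - 1 →
    Subsingleton (extMod R M R i) ∨ isCMofDim R (extMod R M R i) (d - i)

/-- `M` is sequentially Cohen-Macaulay: it has a filtration with Cohen-Macaulay quotients
of strictly increasing dimensions. -/
def isSeqCM (R : Type) [CommRing R] [IsLocalRing R] (M : Type) [AddCommGroup M] [Module R M] :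
    Prop :=
  ∃ (r : ℕ) (Φ : Fin (r + 1) → Submodule R M), Φ 0 = ⊥ ∧ Φ (Fin.last r) = ⊤ ∧ StrictMono Φ ∧
    (∀ i : Fin r, isCM R (↥(Φ i.succ) ⧸ (Φ i.castSucc).comap (Φ i.succ).subtype)) ∧
    (∀ i j : Fin r, i < j →
      mdim R (↥(Φ i.succ) ⧸ (Φ i.castSucc).comap (Φ i.succ).subtype) <
      mdim R (↥(Φ j.succ) ⧸ (Φ j.castSucc).comap (Φ j.succ).subtype))

/-- `ω` is a canonical module of the `d`-dimensional local ring `R`: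
`Ext^i_R(k, ω) = 0` for `i ≠ d` and `Ext^d_R(k, ω) ≅ k`. -/
def isCanonicalModule (R : Type) [CommRing R] [IsLocalRing R] (d : ℕ) (ω : Type)
    [AddCommGroup ω] [Module R ω] : Prop :=
  Module.Finite R ω ∧ (∀ i : ℕ, i ≠ d → Subsingleton (extMod R (ResidueField R) ω i)) ∧
    Nonempty ((extMod R (ResidueField R) ω d) ≃ₗ[R] ResidueField R)

/-- The local cohomology module `H^i_𝔪(M)` supported at the maximal ideal. -/
noncomputable def lcMod (R : Type) [CommRing R] [IsLocalRing R] (i : ℕ) (M : Type)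
    [AddCommGroup M] [Module R M] : ModuleCat R :=
  (localCohomology (maximalIdeal R) i).obj (ModuleCat.of R M)

/-- The 𝔪-torsion submodule `Γ_𝔪(M) = {x ∈ M | 𝔪^n x = 0 for some n}`. -/
noncomputable def mTorsion (R : Type) [CommRing R] [IsLocalRing R] (M : Type) [AddCommGroup M]
    [Module R M] : Submodule R M :=
  ⨆ n : ℕ, Submodule.torsionBySet R M ((maximalIdeal R ^ n : Ideal R) : Set R)

/-- The natural evaluation (biduality) map `M → Hom_R(Hom_R(M, ω), ω)`. -/
noncomputable def evMap (R : Type) [CommRing R] (M ω : Type) [AddCommGroup M] [Module R M]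
    [AddCommGroup ω] [Module R ω] : M →ₗ[R] ((M →ₗ[R] ω) →ₗ[R] ω) :=
  (LinearMap.id : (M →ₗ[R] ω) →ₗ[R] (M →ₗ[R] ω)).flip

/-- Serre's condition `(S₂)` on the punctured spectrum. -/
def serreS2Punctured (R : Type) [CommRing R] [IsLocalRing R] (M : Type) [AddCommGroup M]
    [Module R M] : Prop :=
  ∀ (𝔭 : Ideal R) [𝔭.IsPrime], 𝔭 ≠ maximalIdeal R →
    min (2 : WithBot ℕ∞) (mdim (Localization.AtPrime 𝔭) (LocalizedModule 𝔭.primeCompl M)) ≤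
      (rdepth (Localization.AtPrime 𝔭) (LocalizedModule 𝔭.primeCompl M) : WithBot ℕ∞)

section ExtComparison

variable {R : Type} [CommRing R]

lemma CategoryTheory.ProjectiveResolution.extMk_eq_zero_iff'
    {X Y : ModuleCat.{0} R} (P : ProjectiveResolution X) {n : ℕ}
    (f : P.complex.X n ⟶ Y) (m : ℕ) (hm : n + 1 = m)
    (hf : P.complex.d m n ≫ f = 0) :
    P.extMk f m hm hf = 0 ↔ ∃ p, ∃ (g : P.complex.X p ⟶ Y), P.complex.d n p ≫ g = f := by
  obtain _ | n := n
  · refine ⟨fun h ↦ ⟨0, 0, ?_⟩, ?_⟩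
    · rw [← P.extEquivCohomologyClass.apply_eq_iff_eq, P.extEquivCohomologyClass_extMk,
        P.extEquivCohomologyClass_zero, CochainComplex.HomComplex.CohomologyClass.mk_eq_zero_iff,
        CochainComplex.HomComplex.Cocycle.toSingleMk_mem_coboundaries_iff _ _ _ _ _ 1 (by lia)] at h
      obtain ⟨g, hg⟩ := h
      have : P.cochainComplex.d (-(0 : ℕ)) 1 = 0 :=
        (CochainComplex.isZero_of_isStrictlyLE P.cochainComplex 0 1).eq_of_tgt _ _
      rw [this] at hg
      simp only [Limits.zero_comp] at hg ⊢
      rw [← cancel_epi (P.cochainComplexXIso (-(0 : ℕ)) 0 rfl).hom, ← hg]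
      simp
    · rintro ⟨p, g, rfl⟩
      simp
  · rw [P.extMk_eq_zero_iff f m hm hf n rfl]
    refine ⟨fun ⟨g, hg⟩ ↦ ⟨n, g, hg⟩, fun ⟨p, g, hg⟩ ↦ ?_⟩
    by_cases hp : p = n
    · subst hp
      exact ⟨g, hg⟩
    · refine ⟨0, ?_⟩
      rw [← hg, P.complex.shape _ _ (fun h ↦ hp (Nat.succ_injective h))]
      simp

variable {X Y : ModuleCat.{0} R} (P : ProjectiveResolution X) (n : ℕ)

/-- The morphism underlying a cocycle of the complex `Hom(P, Y)`. -/
noncomputable def CategoryTheory.ProjectiveResolution.cocycleHom :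
    (P.complex.linearYonedaObj R Y).cycles n →ₗ[R] (P.complex.X n ⟶ Y) :=
  ((P.complex.linearYonedaObj R Y).iCycles n).hom

lemma CategoryTheory.ProjectiveResolution.d_comp_cocycleHom
    (z : (P.complex.linearYonedaObj R Y).cycles n) :
    P.complex.d (n + 1) n ≫ P.cocycleHom n z = 0 :=
  congr($((P.complex.linearYonedaObj R Y).iCycles_d n (n + 1)) z)

/-- The class in `Ext` of a cocycle of the complex `Hom(P, Y)`. -/
noncomputable def CategoryTheory.ProjectiveResolution.cyclesToExt :
    (P.complex.linearYonedaObj R Y).cycles n →ₗ[R] Abelian.Ext X Y n where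
  toFun z := P.extMk (P.cocycleHom n z) (n + 1) rfl (P.d_comp_cocycleHom n z)
  map_add' x y := by
    rw [P.add_extMk]
    congr 1
    exact map_add _ _ _
  map_smul' r x := by
    rw [RingHom.id_apply, Abelian.Ext.smul_eq_comp_mk₀, P.extMk_comp_mk₀]
    congr 1
    rw [Linear.comp_smul, Category.comp_id]
    exact map_smul _ _ _

lemma CategoryTheory.ProjectiveResolution.cyclesToExt_surjective :
    Function.Surjective (P.cyclesToExt (Y := Y) n) := by
  intro e
  obtain ⟨f, hf, rfl⟩ := P.extMk_surjective e (n + 1) rfl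
  have := ShortComplex.exact_of_f_is_kernel
    (ShortComplex.mk ((P.complex.linearYonedaObj R Y).iCycles n)
      ((P.complex.linearYonedaObj R Y).d n (n + 1))
      (HomologicalComplex.iCycles_d _ _ _))
      ((P.complex.linearYonedaObj R Y).cyclesIsKernel n (n + 1) (by simp))
  rw [ShortComplex.moduleCat_exact_iff] at this
  obtain ⟨z, hz⟩ := this f hf
  refine ⟨z, ?_⟩
  change P.extMk (P.cocycleHom n z) (n + 1) rfl (P.d_comp_cocycleHom n z) = _
  congr 1

lemma CategoryTheory.ProjectiveResolution.cyclesToExt_eq_zero_iff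
    (z : (P.complex.linearYonedaObj R Y).cycles n) :
    P.cyclesToExt n z = 0 ↔ (P.complex.linearYonedaObj R Y).homologyπ n z = 0 := by
  change P.extMk (P.cocycleHom n z) (n + 1) rfl (P.d_comp_cocycleHom n z) = 0 ↔ _
  rw [P.extMk_eq_zero_iff']
  constructor
  · rintro ⟨p, g, hg⟩
    have h1 : z = (P.complex.linearYonedaObj R Y).toCycles p n g := by
      have hinj : Function.Injective ((P.complex.linearYonedaObj R Y).iCycles n) :=
        (ModuleCat.mono_iff_injective _).mp inferInstance
      apply hinj
      exact hg.symm.trans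
        (congr($((P.complex.linearYonedaObj R Y).toCycles_i p n) g)).symm
    rw [h1]
    exact congr($((P.complex.linearYonedaObj R Y).toCycles_comp_homologyπ p n) g)
  · intro h
    have := ShortComplex.exact_of_g_is_cokernel
      (ShortComplex.mk ((P.complex.linearYonedaObj R Y).toCycles
        ((ComplexShape.up ℕ).prev n) n)
        ((P.complex.linearYonedaObj R Y).homologyπ n) (by simp))
        ((P.complex.linearYonedaObj R Y).homologyIsCokernel _ n rfl)
    rw [ShortComplex.moduleCat_exact_iff] at this
    obtain ⟨g, hg⟩ := this z h
    refine ⟨(ComplexShape.up ℕ).prev n, g, ?_⟩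
    refine (congr($((P.complex.linearYonedaObj R Y).toCycles_i
      ((ComplexShape.up ℕ).prev n) n) g)).symm.trans ?_
    exact congrArg ((P.complex.linearYonedaObj R Y).iCycles n) hg

/-- The cohomology of `Hom(P, Y)` is linearly equivalent to `Ext X Y n`. -/
noncomputable def CategoryTheory.ProjectiveResolution.homologyEquivExt :
    (P.complex.linearYonedaObj R Y).homology n ≃ₗ[R] Abelian.Ext X Y n :=
  (LinearMap.quotKerEquivOfSurjective ((P.complex.linearYonedaObj R Y).homologyπ n).hom
    ((ModuleCat.epi_iff_surjective _).mp inferInstance)).symm ≪≫ₗ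
  Submodule.quotEquivOfEq _ _ (by
    ext z
    exact (P.cyclesToExt_eq_zero_iff n z).symm) ≪≫ₗ
  LinearMap.quotKerEquivOfSurjective (P.cyclesToExt n) (P.cyclesToExt_surjective n)

lemma CategoryTheory.ProjectiveResolution.homologyEquivExt_π
    (z : (P.complex.linearYonedaObj R Y).cycles n) :
    P.homologyEquivExt n ((P.complex.linearYonedaObj R Y).homologyπ n z) =
      P.cyclesToExt n z := by
  have h : (LinearMap.quotKerEquivOfSurjective
      ((P.complex.linearYonedaObj R Y).homologyπ n).hom
      ((ModuleCat.epi_iff_surjective _).mp inferInstance)).symm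
      ((P.complex.linearYonedaObj R Y).homologyπ n z) = Submodule.Quotient.mk z := by
    rw [LinearEquiv.symm_apply_eq]
    rfl
  simp only [homologyEquivExt, LinearEquiv.trans_apply, h]
  rfl

/-- The comparison of the two definitions of `Ext` in Mathlib. -/
noncomputable def extCompare :
    ((Ext R (ModuleCat R) n).obj (op X)).obj Y ≃ₗ[R] Abelian.Ext X Y n :=
  (P.isoExt n Y).toLinearEquiv ≪≫ₗ P.homologyEquivExt n

end ExtComparison

lemma CategoryTheory.Iso.inv_comm_square {C : Type*} [Category* C] {A B A' B' : C} {α : A ≅ B}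
    {β : A' ≅ B'} {f : A ⟶ A'} {g : B ⟶ B'} (h : f ≫ β.hom = α.hom ≫ g) :
    g ≫ β.inv = α.inv ≫ f := by
  rw [Iso.comp_inv_eq, Category.assoc, h, Iso.inv_hom_id_assoc]

lemma HomologicalComplex.homologyUnop_inv_naturality {V ι : Type*} [Category* V]
    [Limits.HasZeroMorphisms V] {c : ComplexShape ι} {K L : HomologicalComplex Vᵒᵖ c}
    (ψ : K ⟶ L) (n : ι) [K.HasHomology n] [L.HasHomology n] :
    (homologyMap ψ n).unop ≫ (K.homologyUnop n).inv =
      (L.homologyUnop n).inv ≫ homologyMap ((unopFunctor V c).map ψ.op) n := by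
  have h := homologyOp_hom_naturality ((unopFunctor V c).map ψ.op) n
  exact Iso.inv_comm_square (α := L.homologyUnop n) (β := K.homologyUnop n)
    congr(Quiver.Hom.unop $h).symm

lemma comp_inv_comm_square {C : Type*} [Category* C] {A B A' B' A'' B'' : C} {f : A ⟶ B}
    {g : A' ⟶ B'} {h : A'' ⟶ B''} {a : A ⟶ A'} {b : B ⟶ B'} {a' : A' ⟶ A''} {b' : B' ⟶ B''}
    (h₁ : f ≫ b = a ≫ g) (h₂ : g ≫ b' = a' ≫ h) : f ≫ b ≫ b' = (a ≫ a') ≫ h := by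
  rw [reassoc_of% h₁, h₂, Category.assoc]

section ExtNaturality

variable {R : Type} [CommRing R] {X X' Y : ModuleCat.{0} R}
  (Q : ProjectiveResolution X) (P : ProjectiveResolution X')

/-- The map of complexes `Hom(P, Y) ⟶ Hom(Q, Y)` induced by a chain map `Q ⟶ P`. -/
noncomputable def linearYonedaComplexMap (φ : Q.complex ⟶ P.complex) :
    P.complex.linearYonedaObj R Y ⟶ Q.complex.linearYonedaObj R Y :=
  (HomologicalComplex.unopFunctor _ _).map
    ((((linearYoneda R (ModuleCat R)).obj Y).rightOp.mapHomologicalComplex _).map φ).op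

lemma isoExt_hom_naturality (f : X ⟶ X') (φ : ProjectiveResolution.Hom Q P f) (n : ℕ) :
    ((Ext R (ModuleCat R) n).map f.op).app Y ≫ (Q.isoExt n Y).hom =
      (P.isoExt n Y).hom ≫
        HomologicalComplex.homologyMap (linearYonedaComplexMap Q P φ.hom) n := by
  have h1 := ProjectiveResolution.isoLeftDerivedObj_inv_naturality f Q P φ.hom
    (by simpa using φ.hom_f_zero_comp_π_f_zero) ((linearYoneda R (ModuleCat R)).obj Y).rightOp n
  have h2 : ((Ext R (ModuleCat R) n).map f.op).app Y ≫
      (Q.isoLeftDerivedObj ((linearYoneda R (ModuleCat R)).obj Y).rightOp n).inv.unop =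
      (P.isoLeftDerivedObj ((linearYoneda R (ModuleCat R)).obj Y).rightOp n).inv.unop ≫
      (HomologicalComplex.homologyMap
        ((((linearYoneda R (ModuleCat R)).obj Y).rightOp.mapHomologicalComplex _).map φ.hom)
        n).unop := congr(Quiver.Hom.unop $h1)
  have h3 := HomologicalComplex.homologyUnop_inv_naturality
    ((((linearYoneda R (ModuleCat R)).obj Y).rightOp.mapHomologicalComplex _).map φ.hom) n
  exact comp_inv_comm_square h2 h3

lemma extCompare_naturality (f : X ⟶ X') (n : ℕ)
    (e : ((Ext R (ModuleCat R) n).obj (op X')).obj Y) :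
    extCompare Q n (((Ext R (ModuleCat R) n).map f.op).app Y e) =
      (Abelian.Ext.mk₀ f).comp (extCompare P n e) (zero_add n) := by
  let φ : ProjectiveResolution.Hom Q P f :=
    ⟨ProjectiveResolution.lift f Q P, by
      simpa using ProjectiveResolution.lift_commutes_zero f Q P⟩
  have h1 := congr($(isoExt_hom_naturality (Y := Y) Q P f φ n) e)
  obtain ⟨z, hz⟩ : ∃ z, (P.complex.linearYonedaObj R Y).homologyπ n z =
      (P.isoExt n Y).hom e := (ModuleCat.epi_iff_surjective _).mp inferInstance _
  have h2 : (Q.isoExt n Y).hom (((Ext R (ModuleCat R) n).map f.op).app Y e) =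
      (Q.complex.linearYonedaObj R Y).homologyπ n
        (HomologicalComplex.cyclesMap (linearYonedaComplexMap Q P φ.hom) n z) := by
    refine h1.trans ?_
    change HomologicalComplex.homologyMap (linearYonedaComplexMap (Y := Y) Q P φ.hom) n
      ((P.isoExt n Y).hom e) = _
    rw [← hz]
    exact congr($(HomologicalComplex.homologyπ_naturality
      (linearYonedaComplexMap (Y := Y) Q P φ.hom) n) z)
  change Q.homologyEquivExt n ((Q.isoExt n Y).hom _) =
    (Abelian.Ext.mk₀ f).comp (P.homologyEquivExt n ((P.isoExt n Y).hom e)) _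
  rw [h2, ← hz, ProjectiveResolution.homologyEquivExt_π, ProjectiveResolution.homologyEquivExt_π]
  change Q.extMk (Q.cocycleHom n _) (n + 1) rfl (Q.d_comp_cocycleHom n _) =
    (Abelian.Ext.mk₀ f).comp
      (P.extMk (P.cocycleHom n z) (n + 1) rfl (P.d_comp_cocycleHom n z)) _
  rw [ProjectiveResolution.mk₀_comp_extMk _ _ _ _ φ]
  congr 1
  exact congr($(HomologicalComplex.cyclesMap_i (linearYonedaComplexMap (Y := Y) Q P φ.hom) n) z)

end ExtNaturality

namespace ModExt

variable {R : Type} [CommRing R]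

/-- `Ext` groups of unbundled modules. -/
abbrev E (R : Type) [CommRing R] (M N : Type) [AddCommGroup M] [Module R M] [AddCommGroup N]
    [Module R N] (n : ℕ) : Type :=
  Abelian.Ext (ModuleCat.of R M) (ModuleCat.of R N) n

variable {A B C X Y N : Type} [AddCommGroup A] [Module R A] [AddCommGroup B] [Module R B]
  [AddCommGroup C] [Module R C] [AddCommGroup X] [Module R X] [AddCommGroup Y] [Module R Y]
  [AddCommGroup N] [Module R N]

/-- Precomposition with a linear map on `Ext`. -/
noncomputable def pre (f : A →ₗ[R] B) (N : Type) [AddCommGroup N] [Module R N] (n : ℕ) :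
    E R B N n →ₗ[R] E R A N n :=
  Abelian.Ext.bilinearCompOfLinear R _ _ _ 0 n n (zero_add n)
    (Abelian.Ext.mk₀ (ModuleCat.ofHom f))

/-- Postcomposition with a linear map on `Ext`. -/
noncomputable def post (X : Type) [AddCommGroup X] [Module R X] (f : A →ₗ[R] B) (n : ℕ) :
    E R X A n →ₗ[R] E R X B n :=
  (Abelian.Ext.bilinearCompOfLinear R _ _ _ n 0 n (add_zero n)).flip
    (Abelian.Ext.mk₀ (ModuleCat.ofHom f))

/-- `Ext` in degree zero consists of the linear maps. -/
noncomputable def zeroEquiv (X Y : Type) [AddCommGroup X] [Module R X] [AddCommGroup Y]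
    [Module R Y] : (X →ₗ[R] Y) ≃ₗ[R] E R X Y 0 :=
  (ModuleCat.homLinearEquiv (S := R) (M := ModuleCat.of R X) (N := ModuleCat.of R Y)).symm ≪≫ₗ
    (Abelian.Ext.linearEquiv₀ (R := R) (X := ModuleCat.of R X) (Y := ModuleCat.of R Y)).symm

lemma pre_zeroEquiv (f : A →ₗ[R] B) (g : B →ₗ[R] N) :
    pre f N 0 (zeroEquiv B N g) = zeroEquiv A N (g ∘ₗ f) :=
  Abelian.Ext.mk₀_comp_mk₀ _ _

lemma pre_smul_id (r : R) (n : ℕ) (e : E R A N n) :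
    pre (r • LinearMap.id : A →ₗ[R] A) N n e = r • e := by
  change (Abelian.Ext.mk₀ (r • 𝟙 (ModuleCat.of R A))).comp e (zero_add n) = _
  rw [Abelian.Ext.mk₀_smul, Abelian.Ext.smul_comp, Abelian.Ext.mk₀_id_comp]

lemma post_smul_id (r : R) (n : ℕ) (e : E R X A n) :
    post X (r • LinearMap.id : A →ₗ[R] A) n e = r • e :=
  (Abelian.Ext.smul_eq_comp_mk₀ e r).symm

lemma pre_comp (f : A →ₗ[R] B) (g : B →ₗ[R] C) (n : ℕ) (e : E R C N n) :
    pre (g ∘ₗ f) N n e = pre f N n (pre g N n e) :=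
  (Abelian.Ext.mk₀_comp_mk₀_assoc _ _ e).symm

lemma pre_zero (n : ℕ) (e : E R B N n) : pre (0 : A →ₗ[R] B) N n e = 0 := by
  change (Abelian.Ext.mk₀ 0).comp e (zero_add n) = 0
  simp

lemma post_comp (f : A →ₗ[R] B) (g : B →ₗ[R] C) (n : ℕ) (e : E R X A n) :
    post X (g ∘ₗ f) n e = post X g n (post X f n e) := by
  refine Eq.symm ((Abelian.Ext.comp_assoc_of_third_deg_zero _ _ _ (add_zero n)).trans ?_)
  rw [Abelian.Ext.mk₀_comp_mk₀]
  rfl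

lemma post_zero (n : ℕ) (e : E R X A n) : post X (0 : A →ₗ[R] B) n e = 0 := by
  change e.comp (Abelian.Ext.mk₀ 0) (add_zero n) = 0
  simp

lemma pre_id (n : ℕ) (e : E R C N n) : pre (LinearMap.id : C →ₗ[R] C) N n e = e :=
  Abelian.Ext.mk₀_id_comp e

/-- An equivalence in the first variable induces an equivalence on `Ext`. -/
noncomputable def preEquiv (f : A ≃ₗ[R] B) (N : Type) [AddCommGroup N] [Module R N] (n : ℕ) :
    E R B N n ≃ₗ[R] E R A N n :=
  LinearEquiv.ofLinearMap (pre (f : A →ₗ[R] B) N n) (pre (f.symm : B →ₗ[R] A) N n)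
    (by ext e; simp [← pre_comp, pre_id]) (by ext e; simp [← pre_comp, pre_id])

instance [IsNoetherianRing R] [Module.Finite R X] [Module.Finite R N] (n : ℕ) :
    Module.Finite R (E R X N n) :=
  inferInstance

lemma subsingleton_of_projective [Module.Projective R X] (n : ℕ) :
    Subsingleton (E R X N (n + 1)) := by
  have : Projective (ModuleCat.of R X) := (IsProjective.iff_projective X).mp inferInstance
  exact ⟨fun a b ↦ by
    rw [Abelian.Ext.eq_zero_of_projective a, Abelian.Ext.eq_zero_of_projective b]⟩

section Sequences

variable {f : A →ₗ[R] B} {g : B →ₗ[R] C} (hf : Function.Injective f)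
  (hg : Function.Surjective g) (hfg : Function.Exact f g)

include hfg in
lemma shortExact (hf : Function.Injective f)
    (hg : Function.Surjective g) : (ShortComplex.mk (ModuleCat.ofHom f) (ModuleCat.ofHom g) (by
      ext x; exact hfg.apply_apply_eq_zero x)).ShortExact where
  exact := (ShortComplex.ShortExact.moduleCat_exact_iff_function_exact _).mpr hfg
  mono_f := (ModuleCat.mono_iff_injective _).mpr hf
  epi_g := (ModuleCat.epi_iff_surjective _).mpr hg

/-- The contravariant connecting map. -/
noncomputable def preδ (N : Type) [AddCommGroup N] [Module R N] (n : ℕ) :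
    E R A N n →ₗ[R] E R C N (n + 1) :=
  Abelian.Ext.bilinearCompOfLinear R _ _ _ 1 n (n + 1) (add_comm _ _)
    (shortExact hfg hf hg).extClass

/-- The covariant connecting map. -/
noncomputable def postδ (X : Type) [AddCommGroup X] [Module R X] (n : ℕ) :
    E R X C n →ₗ[R] E R X A (n + 1) :=
  (Abelian.Ext.bilinearCompOfLinear R _ _ _ n 1 (n + 1) rfl).flip
    (shortExact hfg hf hg).extClass

lemma pre_postδ (h : X →ₗ[R] Y) (n : ℕ) (e : E R Y C n) :
    pre h A (n + 1) (postδ hf hg hfg Y n e) = postδ hf hg hfg X n (pre h C n e) :=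
  (Abelian.Ext.comp_assoc _ e _ (zero_add n) rfl (by lia)).symm

include hf hg in
lemma pre_exact₂ (hfg : Function.Exact f g) (N : Type) [AddCommGroup N] [Module R N] (n : ℕ) :
    Function.Exact (pre g N n) (pre f N n) := fun e ↦
  ⟨fun h ↦ Abelian.Ext.contravariant_sequence_exact₂ (shortExact hfg hf hg) _ e h, by
    rintro ⟨e, rfl⟩
    rw [← pre_comp, show g ∘ₗ f = 0 from hfg.linearMap_comp_eq_zero]
    exact pre_zero n e⟩

lemma pre_exact₁ (N : Type) [AddCommGroup N] [Module R N] (n : ℕ) :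
    Function.Exact (pre f N n) (preδ hf hg hfg N n) := fun e ↦
  ⟨fun h ↦ Abelian.Ext.contravariant_sequence_exact₁ (shortExact hfg hf hg) _ e (add_comm _ _) h, by
    rintro ⟨e, rfl⟩
    exact (shortExact hfg hf hg).extClass_comp_assoc e (h := add_comm _ _)⟩

lemma pre_exact₃ (N : Type) [AddCommGroup N] [Module R N] (n : ℕ) :
    Function.Exact (preδ hf hg hfg N n) (pre g N (n + 1)) := fun e ↦
  ⟨fun h ↦ Abelian.Ext.contravariant_sequence_exact₃ (shortExact hfg hf hg) _ e h (add_comm _ _), by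
    rintro ⟨e, rfl⟩
    exact (shortExact hfg hf hg).comp_extClass_assoc e (h := add_comm _ _)⟩

include hf hg in
lemma post_exact₂ (hfg : Function.Exact f g) (X : Type) [AddCommGroup X] [Module R X] (n : ℕ) :
    Function.Exact (post X f n) (post X g n) := fun e ↦
  ⟨fun h ↦ Abelian.Ext.covariant_sequence_exact₂ _ (shortExact hfg hf hg) e h, by
    rintro ⟨e, rfl⟩
    rw [← post_comp, show g ∘ₗ f = 0 from hfg.linearMap_comp_eq_zero, post_zero]⟩

lemma post_exact₃ (X : Type) [AddCommGroup X] [Module R X] (n : ℕ) :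
    Function.Exact (post X g n) (postδ hf hg hfg X n) := fun e ↦
  ⟨fun h ↦ Abelian.Ext.covariant_sequence_exact₃ _ (shortExact hfg hf hg) e rfl h, by
    rintro ⟨e, rfl⟩
    refine (Abelian.Ext.comp_assoc_of_second_deg_zero _ _ _ rfl).trans ?_
    refine (congrArg (fun t ↦ e.comp t _) (shortExact hfg hf hg).comp_extClass).trans ?_
    simp⟩

lemma post_exact₁ (X : Type) [AddCommGroup X] [Module R X] (n : ℕ) :
    Function.Exact (postδ hf hg hfg X n) (post X f (n + 1)) := fun e ↦
  ⟨fun h ↦ Abelian.Ext.covariant_sequence_exact₁ _ (shortExact hfg hf hg) e h rfl, by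
    rintro ⟨e, rfl⟩
    refine (Abelian.Ext.comp_assoc_of_third_deg_zero _ _ _ rfl).trans ?_
    refine (congrArg (fun t ↦ e.comp t _) (shortExact hfg hf hg).extClass_comp).trans ?_
    simp⟩

end Sequences

lemma smul_eq_zero_of_left {r : R} (h : ∀ x : X, r • x = 0) {n : ℕ} (e : E R X N n) :
    r • e = 0 := by
  rw [← pre_smul_id, show (r • LinearMap.id : X →ₗ[R] X) = 0 from LinearMap.ext h]
  exact pre_zero n e

end ModExt

/-- The comparison of the statement's `Ext` modules with `Abelian.Ext`. -/
noncomputable def extModEquiv (R : Type) [CommRing R] (M N : Type) [AddCommGroup M] [Module R M]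
    [AddCommGroup N] [Module R N] (i : ℕ) : extMod R M N i ≃ₗ[R] ModExt.E R M N i :=
  extCompare (projectiveResolution (ModuleCat.of R M)) i

namespace ModExt

variable {R : Type} [CommRing R]

/-- Dévissage: a property of finitely generated modules annihilated by `I` that is stable under
extensions can be checked on the quotients `R ⧸ q` by primes `q ⊇ I`. -/
lemma devissage [IsNoetherianRing R] (I : Ideal R)
    (P : (X : Type) → [AddCommGroup X] → [Module R X] → Prop)
    (hzero : ∀ (X : Type) [AddCommGroup X] [Module R X] [Subsingleton X], P X)
    (hequiv : ∀ (X Y : Type) [AddCommGroup X] [Module R X] [AddCommGroup Y] [Module R Y],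
      (X ≃ₗ[R] Y) → P Y → P X)
    (hexact : ∀ (A B C : Type) [AddCommGroup A] [Module R A] [AddCommGroup B] [Module R B]
      [AddCommGroup C] [Module R C] [Module.Finite R A] [Module.Finite R B] [Module.Finite R C]
      (f : A →ₗ[R] B) (g : B →ₗ[R] C),
      Function.Injective f → Function.Surjective g → Function.Exact f g → P A → P C → P B)
    (hprime : ∀ q : Ideal R, q.IsPrime → I ≤ q → P (R ⧸ q))
    (X : Type) [AddCommGroup X] [Module R X] [hX : Module.Finite R X]
    (hI : I ≤ Module.annihilator R X) : P X := by
  induction hX using IsNoetherianRing.induction_on_isQuotientEquivQuotientPrime R with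
  | subsingleton N => exact hzero N
  | quotient N p f =>
    refine hequiv _ _ f (hprime p.1 p.2 (hI.trans ?_))
    rw [f.annihilator_eq, Ideal.annihilator_quotient]
  | exact N₁ N₂ N₃ f g hf hg hfg h₁ h₃ =>
    exact hexact N₁ N₂ N₃ f g hf hg hfg (h₁ (hI.trans (f.annihilator_le_of_injective hf)))
      (h₃ (hI.trans (g.annihilator_le_of_surjective hg)))

/-- The vanishing of the localization of `E` at `p`, for finitely generated `E`. -/
def VanishesAt (p : Ideal R) (E : Type) [AddCommGroup E] [Module R E] : Prop :=
  ∃ s ∉ p, ∀ e : E, s • e = 0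

lemma VanishesAt.of_subsingleton {p : Ideal R} [p.IsPrime] {E : Type} [AddCommGroup E]
    [Module R E] (h : Subsingleton E) : VanishesAt p E :=
  ⟨1, p.one_notMem, fun _ ↦ Subsingleton.elim _ _⟩

lemma VanishesAt.of_equiv {p : Ideal R} {E E' : Type} [AddCommGroup E]
    [Module R E] [AddCommGroup E'] [Module R E'] (f : E ≃ₗ[R] E') (h : VanishesAt p E) :
    VanishesAt p E' := by
  obtain ⟨s, hs, h⟩ := h
  exact ⟨s, hs, fun e ↦ by simpa using congrArg f (h (f.symm e))⟩

lemma VanishesAt.of_exact {p : Ideal R} [p.IsPrime] {A B C : Type} [AddCommGroup A]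
    [Module R A] [AddCommGroup B] [Module R B] [AddCommGroup C] [Module R C]
    {f : A →ₗ[R] B} {g : B →ₗ[R] C} (hfg : Function.Exact f g) (hA : VanishesAt p A)
    (hC : VanishesAt p C) : VanishesAt p B := by
  obtain ⟨s, hs, hA⟩ := hA
  obtain ⟨t, ht, hC⟩ := hC
  refine ⟨s * t, fun h ↦ (Ideal.IsPrime.mem_or_mem ‹_› h).elim hs ht, fun e ↦ ?_⟩
  obtain ⟨a, ha⟩ := (hfg (t • e)).mp (by rw [map_smul, hC])
  rw [mul_smul, ← ha, ← map_smul, hA, map_zero]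

lemma VanishesAt.subsingleton [IsLocalRing R] {E : Type} [AddCommGroup E]
    [Module R E] (h : VanishesAt (maximalIdeal R) E) : Subsingleton E := by
  obtain ⟨s, hs, h⟩ := h
  rw [mem_maximalIdeal, mem_nonunits_iff, not_not] at hs
  exact subsingleton_of_forall_eq 0 fun e ↦ hs.smul_left_cancel.mp (by simpa using h e)

/-- Nakayama's lemma at a prime. -/
lemma VanishesAt.of_smul {p : Ideal R} [p.IsPrime] {E : Type} [AddCommGroup E]
    [Module R E] [Module.Finite R E] {s x : R} (hs : s ∉ p) (hx : x ∈ p)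
    (h : ∀ e : E, ∃ e' : E, s • e = x • e') : VanishesAt p E := by
  obtain ⟨P, hP, -, hP', hP0⟩ :=
    LinearMap.exists_monic_and_natDegree_eq_and_coeff_mem_pow_and_aeval_eq_zero R
      (LinearMap.lsmul R E s) p (by
        rintro _ ⟨e, rfl⟩
        obtain ⟨e', he'⟩ := h e
        rw [LinearMap.lsmul_apply, he']
        exact Submodule.smul_mem_smul hx trivial)
  refine ⟨P.eval s, fun hmem ↦ ?_, fun e ↦ ?_⟩
  · rw [Polynomial.eval_eq_sum_range, Finset.sum_range_succ, hP.coeff_natDegree, one_mul] at hmem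
    refine hs (Ideal.IsPrime.mem_of_pow_mem ‹_› _ ((Ideal.add_mem_iff_right _ ?_).mp hmem))
    refine Ideal.sum_mem _ fun k hk ↦ Ideal.mul_mem_right _ _ ?_
    exact Ideal.pow_le_self (by simp at hk; lia) (hP' k)
  · have := LinearMap.congr_fun hP0 e
    rw [show LinearMap.lsmul R E s = algebraMap R (Module.End R E) s from rfl,
      Polynomial.aeval_algebraMap_apply, Polynomial.coe_aeval_eq_eval] at this
    exact this

variable [IsNoetherianRing R]

lemma exists_ker_toSpanSingleton {p : Ideal R} {Y : Type} [AddCommGroup Y] [Module R Y]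
    (h : p ∈ associatedPrimes R Y) : ∃ y : Y, ∀ r : R, r • y = 0 ↔ r ∈ p := by
  obtain ⟨y, hy⟩ := (isAssociatedPrime_iff.mp h).2
  exact ⟨y, fun r ↦ by rw [hy, Submodule.mem_colon_singleton, Submodule.mem_bot]⟩

lemma exists_injective_of_mem_associatedPrimes {p : Ideal R} {Y : Type} [AddCommGroup Y]
    [Module R Y] (h : p ∈ associatedPrimes R Y) :
    ∃ f : (R ⧸ p) →ₗ[R] Y, Function.Injective f := by
  obtain ⟨y, hy⟩ := exists_ker_toSpanSingleton h
  refine ⟨Submodule.liftQ p (LinearMap.toSpanSingleton R Y y) fun r hr ↦ (hy r).mpr hr,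
    LinearMap.ker_eq_bot.mp (Submodule.ker_liftQ_eq_bot _ _ _ fun r hr ↦ (hy r).mp hr)⟩

lemma mem_associatedPrimes_of_smul_eq_zero_iff {p : Ideal R} (hp : p.IsPrime) {Y : Type}
    [AddCommGroup Y] [Module R Y] {y : Y} (hy : ∀ r : R, r • y = 0 ↔ r ∈ p) :
    p ∈ associatedPrimes R Y := by
  refine isAssociatedPrime_iff.mpr ⟨hp, y, ?_⟩
  ext r
  rw [Submodule.mem_colon_singleton, Submodule.mem_bot, hy]

/-- Vanishing of `Ext(R ⧸ p, N)` locally at `p` in all degrees `≥ n` implies the vanishing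
of `Ext(X, N)` locally at `p` in these degrees. -/
lemma vanishesAt_of_quotient_prime (p : Ideal R) [hp : p.IsPrime] (N : Type) [AddCommGroup N]
    [Module R N] [Module.Finite R N] (n : ℕ)
    (h : ∀ i, n ≤ i → VanishesAt p (E R (R ⧸ p) N i)) (X : Type) [AddCommGroup X] [Module R X]
    [Module.Finite R X] (i : ℕ) (hi : n ≤ i) : VanishesAt p (E R X N i) := by
  have key (I : Ideal R) (H : ∀ q : Ideal R, q.IsPrime → I ≤ q →
      ∀ i, n ≤ i → VanishesAt p (E R (R ⧸ q) N i)) (X : Type) [AddCommGroup X] [Module R X]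
      [Module.Finite R X] (hI : I ≤ Module.annihilator R X) :
      ∀ i, n ≤ i → VanishesAt p (E R X N i) := by
    refine devissage I (fun X _ _ ↦ ∀ i, n ≤ i → VanishesAt p (E R X N i)) ?_ ?_ ?_ H X hI
    · intro X _ _ _ i _
      refine ⟨1, p.one_notMem, smul_eq_zero_of_left fun x ↦ Subsingleton.elim _ _⟩
    · intro X Y _ _ _ _ f hY i hi
      exact (hY i hi).of_equiv (preEquiv f N i)
    · intro A B C _ _ _ _ _ _ _ _ _ f g hf hg hfg hA hC i hi
      exact .of_exact (pre_exact₂ hf hg hfg N i) (hC i hi) (hA i hi)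
  have hprime (q : Ideal R) : q.IsPrime → ∀ i, n ≤ i → VanishesAt p (E R (R ⧸ q) N i) := by
    induction q using IsNoetherian.induction with
    | hgt q IH =>
    intro hq i hi
    by_cases hqp : q ≤ p
    · obtain rfl | hlt := hqp.eq_or_lt
      · exact h i hi
      obtain ⟨x, hxp, hxq⟩ := SetLike.exists_of_lt hlt
      have hinj : Function.Injective (x • LinearMap.id : (R ⧸ q) →ₗ[R] (R ⧸ q)) := by
        rw [← LinearMap.ker_eq_bot, LinearMap.ker_eq_bot']
        intro m hm
        obtain ⟨m, rfl⟩ := Ideal.Quotient.mk_surjective m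
        replace hm : Ideal.Quotient.mk q (x * m) = 0 := hm
        rw [Ideal.Quotient.eq_zero_iff_mem] at hm ⊢
        exact (hq.mem_or_mem hm).resolve_left hxq
      set Q := (R ⧸ q) ⧸ LinearMap.range (x • LinearMap.id : (R ⧸ q) →ₗ[R] (R ⧸ q))
      have hfg : Function.Exact (x • LinearMap.id : (R ⧸ q) →ₗ[R] (R ⧸ q))
        (LinearMap.range (x • LinearMap.id : (R ⧸ q) →ₗ[R] (R ⧸ q))).mkQ :=
        LinearMap.exact_map_mkQ_range _
      have hQ : q ⊔ Ideal.span {x} ≤ Module.annihilator R Q := by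
        refine sup_le ?_ ?_
        · refine le_trans ?_ ((Submodule.mkQ _).annihilator_le_of_surjective
            (Submodule.mkQ_surjective _))
          rw [Ideal.annihilator_quotient]
        · rw [Ideal.span_singleton_le_iff_mem, Module.mem_annihilator]
          intro m
          obtain ⟨m, rfl⟩ := Submodule.mkQ_surjective _ m
          rw [← map_smul, Submodule.mkQ_apply, Submodule.Quotient.mk_eq_zero]
          exact ⟨m, rfl⟩
      obtain ⟨s, hs, hsQ⟩ := key (q ⊔ Ideal.span {x}) (fun q' hq' hle ↦ IH q' (by
        refine lt_of_le_of_ne (le_sup_left.trans hle) ?_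
        rintro rfl
        exact hxq (hle (Ideal.mem_sup_right (Ideal.mem_span_singleton_self x)))) hq') Q hQ
        (i + 1) (by lia)
      refine .of_smul hs hxp fun e ↦ ?_
      obtain ⟨e', he'⟩ := (pre_exact₁ hinj (Submodule.mkQ_surjective _) hfg N i (s • e)).mp
        (by rw [map_smul, hsQ])
      exact ⟨e', by rw [← he', pre_smul_id]⟩
    · obtain ⟨s, hsq, hsp⟩ := SetLike.not_le_iff_exists.mp hqp
      refine ⟨s, hsp, smul_eq_zero_of_left fun x ↦ ?_⟩
      obtain ⟨x, rfl⟩ := Ideal.Quotient.mk_surjective x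
      exact Ideal.Quotient.eq_zero_iff_mem.mpr (Ideal.mul_mem_right x q hsq)
  exact key ⊥ (fun q hq _ ↦ hprime q hq) X bot_le i hi

/-- If `R ⧸ p` embeds in `Y`, the vanishing of `Ext(Y, N)` locally at `p` in degrees `≥ n`
propagates to all finitely generated modules, provided that `Ext(-, N)` vanishes in large
degrees. -/
lemma vanishesAt_of_associatedPrime (p : Ideal R) [hp : p.IsPrime] (N : Type) [AddCommGroup N]
    [Module R N] [Module.Finite R N] {Y : Type} [AddCommGroup Y] [Module R Y]
    [Module.Finite R Y] (hpY : p ∈ associatedPrimes R Y) (n k : ℕ)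
    (hY : ∀ i, n ≤ i → VanishesAt p (E R Y N i))
    (hk : ∀ (X : Type) [AddCommGroup X] [Module R X] [Module.Finite R X] (i : ℕ), k ≤ i →
      VanishesAt p (E R X N i))
    (X : Type) [AddCommGroup X] [Module R X] [Module.Finite R X] (i : ℕ) (hi : n ≤ i) :
    VanishesAt p (E R X N i) := by
  have key (j : ℕ) : ∀ (X : Type) [AddCommGroup X] [Module R X] [Module.Finite R X] (i : ℕ),
      n ≤ i → k ≤ i + j → VanishesAt p (E R X N i) := by
    induction j with
    | zero => exact fun X _ _ _ i _ hi ↦ hk X i hi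
    | succ j ih =>
      intro X _ _ _ i hi hij
      obtain ⟨f, hf⟩ := exists_injective_of_mem_associatedPrimes hpY
      refine vanishesAt_of_quotient_prime p N i (fun i' hi' ↦ ?_) X i le_rfl
      exact .of_exact (pre_exact₁ hf (Submodule.mkQ_surjective _)
        (LinearMap.exact_map_mkQ_range f) N i') (hY i' (by lia)) (ih _ _ (by lia) (by lia))
  exact key k X i hi (by lia)

/-- If `Ext(k, N)` vanishes in degrees `≥ n`, then so does `Ext(X, N)`. -/
lemma subsingleton_of_residueField [IsLocalRing R] (N : Type) [AddCommGroup N]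
    [Module R N] [Module.Finite R N] (n : ℕ)
    (h : ∀ i, n ≤ i → Subsingleton (E R (ResidueField R) N i)) (X : Type) [AddCommGroup X]
    [Module R X] [Module.Finite R X] (i : ℕ) (hi : n ≤ i) : Subsingleton (E R X N i) :=
  (vanishesAt_of_quotient_prime (maximalIdeal R) N n
    (fun i hi ↦ .of_subsingleton (h i hi)) X i hi).subsingleton

end ModExt

namespace ModExt

open RingTheory.Sequence
open scoped Pointwise

variable {R : Type} [CommRing R]

lemma exact_smul_id_mkQ (x : R) (V : Type) [AddCommGroup V] [Module R V] :
    Function.Exact (x • LinearMap.id : V →ₗ[R] V)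
      (Submodule.mkQ (x • ⊤ : Submodule R V) : V →ₗ[R] QuotSMulTop x V) := by
  intro v
  rw [Submodule.mkQ_apply, Submodule.Quotient.mk_eq_zero, Submodule.mem_smul_pointwise_iff_exists]
  simp

lemma injective_smul_id {x : R} {V : Type} [AddCommGroup V] [Module R V]
    (hx : IsSMulRegular V x) : Function.Injective (x • LinearMap.id : V →ₗ[R] V) := hx

/-- If `x` is a nonzerodivisor on `V` and kills `X`, the connecting map
`Ext^n(X, V/xV) → Ext^{n+1}(X, V)` is bijective as soon as `Ext^n(X, V)` vanishes. -/
lemma postδ_bijective {x : R} {V : Type} [AddCommGroup V] [Module R V] (hx : IsSMulRegular V x)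
    {X : Type} [AddCommGroup X] [Module R X] (hX : ∀ m : X, x • m = 0) (n : ℕ)
    (h : Subsingleton (E R X V n)) :
    Function.Bijective (postδ (injective_smul_id hx) (Submodule.mkQ_surjective _)
      (exact_smul_id_mkQ x V) X n) := by
  constructor
  · rw [← LinearMap.ker_eq_bot, LinearMap.ker_eq_bot']
    intro e he
    obtain ⟨e', rfl⟩ := (post_exact₃ (injective_smul_id hx) (Submodule.mkQ_surjective _)
      (exact_smul_id_mkQ x V) X n e).mp he
    rw [Subsingleton.elim e' 0, map_zero]
  · intro e
    refine (post_exact₁ (injective_smul_id hx) (Submodule.mkQ_surjective _)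
      (exact_smul_id_mkQ x V) X n e).mp ?_
    rw [post_smul_id]
    exact smul_eq_zero_of_left hX e

variable [IsLocalRing R]

/-- The functor `Ext^j(-, V)` is a duality-like functor on the modules annihilated by `J`: it is
exact there, the lower `Ext`s vanish and its value at the residue field is the residue field. -/
structure IsDualizingAt (J : Ideal R) (V : Type) [AddCommGroup V] [Module R V] (j : ℕ) :
    Prop where
  subsingleton : ∀ (X : Type) [AddCommGroup X] [Module R X] [Module.Finite R X],
    J ≤ Module.annihilator R X → ∀ i < j, Subsingleton (E R X V i)
  surjective : ∀ (A B : Type) [AddCommGroup A] [Module R A] [AddCommGroup B] [Module R B]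
    [Module.Finite R A] [Module.Finite R B] (f : A →ₗ[R] B), Function.Injective f →
    J ≤ Module.annihilator R B → Function.Surjective (pre f V j)
  nonempty : Nonempty (E R (ResidueField R) V j ≃ₗ[R] ResidueField R)

lemma smul_residueField {x : R} (hx : x ∈ maximalIdeal R) (m : ResidueField R) : x • m = 0 := by
  rw [Algebra.smul_def, show algebraMap R (ResidueField R) x = 0 from
    (residue_eq_zero_iff x).mpr hx, zero_mul]

instance : Module.Finite R (ResidueField R) :=
  inferInstanceAs (Module.Finite R (R ⧸ maximalIdeal R))

lemma IsDualizingAt.quotSMulTop {J : Ideal R} {V : Type} [AddCommGroup V] [Module R V] {j : ℕ}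
    (h : IsDualizingAt J V (j + 1)) (hJ : J ≤ maximalIdeal R) {x : R} (hxJ : x ∈ J)
    (hx : IsSMulRegular V x) : IsDualizingAt J (QuotSMulTop x V) j where
  subsingleton X _ _ _ hX i hi := by
    have := h.subsingleton X hX (i + 1) (by lia)
    exact (postδ_bijective hx (Module.mem_annihilator.mp (hX hxJ)) i
      (h.subsingleton X hX i (by lia))).injective.subsingleton
  surjective A B _ _ _ _ _ _ f hf hB := by
    have hA := hB.trans (f.annihilator_le_of_injective hf)
    intro e
    obtain ⟨e', he'⟩ := h.surjective A B f hf hB (postδ (injective_smul_id hx)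
      (Submodule.mkQ_surjective _) (exact_smul_id_mkQ x V) A j e)
    obtain ⟨e'', rfl⟩ := (postδ_bijective hx (Module.mem_annihilator.mp (hB hxJ)) j
      (h.subsingleton B hB j (by lia))).surjective e'
    refine ⟨e'', (postδ_bijective hx (Module.mem_annihilator.mp (hA hxJ)) j
      (h.subsingleton A hA j (by lia))).injective ?_⟩
    rw [← he', pre_postδ]
  nonempty := by
    have hk := smul_residueField (hJ hxJ)
    exact ⟨LinearEquiv.ofBijective _ (postδ_bijective hx hk j
      (h.subsingleton _ (hJ.trans fun y hy ↦ Module.mem_annihilator.mpr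
        (smul_residueField hy)) j (by lia))) ≪≫ₗ h.nonempty.some⟩

variable [IsNoetherianRing R]

lemma length_linearMap_le {J : Ideal R} (hJ : ∀ q : Ideal R, q.IsPrime → J ≤ q →
    q = maximalIdeal R) {W : Type} [AddCommGroup W] [Module R W] (h : IsDualizingAt J W 0)
    (X : Type) [AddCommGroup X] [Module R X] [Module.Finite R X]
    (hX : J ≤ Module.annihilator R X) : Module.length R (X →ₗ[R] W) ≤ Module.length R X := by
  refine devissage J (fun X _ _ ↦ Module.length R (X →ₗ[R] W) ≤ Module.length R X) ?_ ?_ ?_ ?_ X hX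
  · intro X _ _ _
    rw [Module.length_eq_zero]
    exact bot_le
  · intro X Y _ _ _ _ f hY
    rwa [f.length_eq, (LinearEquiv.congrLeft W R f).length_eq]
  · intro A B C _ _ _ _ _ _ _ _ _ f g hf hg hfg hA hC
    rw [Module.length_eq_add_of_exact f g hf hg hfg, add_comm]
    have hex : Function.Exact (LinearMap.lcomp R W g) (LinearMap.lcomp R W f) :=
      LinearMap.exact_lcomp_of_exact_of_surjective W hfg hg
    rw [Module.length_eq_add_of_exact (LinearMap.ker (LinearMap.lcomp R W f)).subtype
      (LinearMap.lcomp R W f).rangeRestrict (Submodule.subtype_injective _)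
      (LinearMap.surjective_rangeRestrict _) (LinearMap.exact_iff.mpr (by simp))]
    refine add_le_add (le_trans ?_ hC) (le_trans ?_ hA)
    · rw [LinearMap.exact_iff.mp hex]
      exact Module.length_le_of_surjective _ (LinearMap.surjective_rangeRestrict _)
    · exact Module.length_le_of_injective _ (Submodule.subtype_injective _)
  · intro q hq hle
    obtain rfl := hJ q hq hle
    exact ((zeroEquiv _ _ ≪≫ₗ h.nonempty.some : (ResidueField R →ₗ[R] W) ≃ₗ[R] _).length_eq).le

omit [IsNoetherianRing R] in
lemma exists_linearMap_apply_ne_zero {J : Ideal R}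
    {W : Type} [AddCommGroup W] [Module R W] (h : IsDualizingAt J W 0)
    (X : Type) [AddCommGroup X] [Module R X] [Module.Finite R X]
    (hX : J ≤ Module.annihilator R X) {x : X} (hx : x ≠ 0) : ∃ f : X →ₗ[R] W, f x ≠ 0 := by
  have hann : LinearMap.ker (LinearMap.toSpanSingleton R X x) ≤ maximalIdeal R := by
    refine le_maximalIdeal fun htop ↦ hx ?_
    have : (1 : R) ∈ LinearMap.ker (LinearMap.toSpanSingleton R X x) := htop ▸ trivial
    simpa using this
  let π : LinearMap.range (LinearMap.toSpanSingleton R X x) →ₗ[R] ResidueField R :=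
    (Submodule.liftQ _ (IsScalarTower.toAlgHom R R (ResidueField R)).toLinearMap
      (by intro r hr; exact (residue_eq_zero_iff r).mpr (hann hr))) ∘ₗ
    (LinearMap.quotKerEquivRange (LinearMap.toSpanSingleton R X x)).symm.toLinearMap
  let y : LinearMap.range (LinearMap.toSpanSingleton R X x) :=
    ⟨x, 1, by simp⟩
  have hy : π y = 1 := by
    have : (LinearMap.quotKerEquivRange (LinearMap.toSpanSingleton R X x)).symm y =
        Submodule.Quotient.mk 1 := by
      rw [LinearEquiv.symm_apply_eq]
      ext
      exact (one_smul R x).symm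
    simp only [π, LinearMap.comp_apply, LinearEquiv.coe_coe, this]
    exact map_one (algebraMap R (ResidueField R))
  obtain ⟨e⟩ := h.nonempty
  let g : ResidueField R →ₗ[R] W := (zeroEquiv _ _).symm (e.symm 1)
  have hg : g ≠ 0 := by simp [g]
  have hg1 : g 1 ≠ 0 := fun h1 ↦ hg (by
    ext m
    obtain ⟨m, rfl⟩ := residue_surjective m
    have : residue R m = m • (1 : ResidueField R) := by
      rw [Algebra.smul_def, mul_one]; rfl
    rw [this, map_smul, h1, smul_zero, LinearMap.zero_apply])
  obtain ⟨e', he'⟩ := h.surjective _ X (LinearMap.range (LinearMap.toSpanSingleton R X x)).subtype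
    (Submodule.subtype_injective _) hX (zeroEquiv _ _ (g ∘ₗ π))
  obtain ⟨f, rfl⟩ := (zeroEquiv _ _).surjective e'
  rw [pre_zeroEquiv] at he'
  have := LinearMap.congr_fun ((zeroEquiv _ _).injective he') y
  refine ⟨f, ?_⟩
  rwa [show f x = _ from this, LinearMap.comp_apply, hy]

/-- Matlis duality over an Artinian ring: the endomorphisms of the dualizing module are
homotheties. -/
lemma exists_eq_smul_id_of_isDualizingAt_zero {J : Ideal R}
    (hJ : ∀ q : Ideal R, q.IsPrime → J ≤ q → q = maximalIdeal R)
    (hlen : Module.length R (R ⧸ J) ≠ ⊤)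
    {W : Type} [AddCommGroup W] [Module R W] [Module.Finite R W] (h : IsDualizingAt J W 0)
    (hW : J ≤ Module.annihilator R W) (g : W →ₗ[R] W) : ∃ r : R, g = r • LinearMap.id := by
  have hRJ : J ≤ Module.annihilator R (R ⧸ J) := (Ideal.annihilator_quotient (I := J)).ge
  let F : (R ⧸ J) →ₗ[R] (W →ₗ[R] W) := Submodule.liftQ J
    (LinearMap.toSpanSingleton R (W →ₗ[R] W) LinearMap.id) (by
      intro r hr
      ext w
      simpa using Module.mem_annihilator.mp (hW hr) w)
  have hF : Function.Injective F := by
    rw [← LinearMap.ker_eq_bot, LinearMap.ker_eq_bot']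
    intro a ha
    by_contra hne
    obtain ⟨f, hf⟩ := exists_linearMap_apply_ne_zero h (R ⧸ J) hRJ hne
    obtain ⟨a, rfl⟩ := Ideal.Quotient.mk_surjective a
    refine hf ?_
    have : Ideal.Quotient.mk J a = a • (1 : R ⧸ J) := by
      rw [Algebra.smul_def, mul_one]; rfl
    rw [this, map_smul]
    exact LinearMap.congr_fun ha (f 1)
  have hle : Module.length R (W →ₗ[R] W) ≤ Module.length R (R ⧸ J) := by
    refine (length_linearMap_le hJ h W hW).trans (le_trans ?_ (length_linearMap_le hJ h _ hRJ))
    refine Module.length_le_of_surjective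
      (LinearMap.applyₗ (1 : R ⧸ J) : ((R ⧸ J) →ₗ[R] W) →ₗ[R] W) fun w ↦ ?_
    refine ⟨Submodule.liftQ J (LinearMap.toSpanSingleton R W w)
      fun r hr ↦ Module.mem_annihilator.mp (hW hr) w, ?_⟩
    exact one_smul R w
  have hsurj : Function.Surjective F := by
    rw [← LinearMap.range_eq_top, ← Submodule.Quotient.subsingleton_iff,
      ← Module.length_eq_zero_iff (R := R)]
    have := Module.length_eq_add_of_exact F (LinearMap.range F).mkQ hF
      (Submodule.mkQ_surjective _) (LinearMap.exact_map_mkQ_range _)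
    rw [this] at hle
    have := (ENat.add_le_add_iff_left hlen).mp (hle.trans (add_zero _).ge)
    exact le_antisymm this bot_le
  obtain ⟨r, hr⟩ := hsurj g
  obtain ⟨r, rfl⟩ := Ideal.Quotient.mk_surjective r
  exact ⟨r, hr.symm⟩

/-- The property that every endomorphism is a homothety lifts along a nonzerodivisor. -/
lemma exists_eq_smul_id_of_quotSMulTop {x : R} (hxm : x ∈ maximalIdeal R) {V : Type}
    [AddCommGroup V] [Module R V] [Module.Finite R V] (hx : IsSMulRegular V x)
    (h : ∀ g : QuotSMulTop x V →ₗ[R] QuotSMulTop x V, ∃ r : R, g = r • LinearMap.id)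
    (g : V →ₗ[R] V) : ∃ r : R, g = r • LinearMap.id := by
  let N : Submodule R (V →ₗ[R] V) := R ∙ LinearMap.id
  have hN : (⊤ : Submodule R (V →ₗ[R] V)) ≤ N ⊔ maximalIdeal R • ⊤ := by
    intro g _
    obtain ⟨r, hr⟩ := h (QuotSMulTop.map x g)
    have hmem (v : V) : ∃ w, x • w = g v - r • v := by
      have := LinearMap.congr_fun hr (Submodule.Quotient.mk v)
      rw [QuotSMulTop.map_apply_mk] at this
      have := (Submodule.Quotient.eq _).mp
        (this : Submodule.Quotient.mk (g v) = Submodule.Quotient.mk (r • v))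
      obtain ⟨w, -, hw⟩ := (Submodule.mem_smul_pointwise_iff_exists _ _ _).mp this
      exact ⟨w, hw⟩
    choose w hw using hmem
    let w' : V →ₗ[R] V :=
      { toFun := w
        map_add' := fun a b ↦ hx (by
          simp only [smul_add, hw, map_add]; abel)
        map_smul' := fun c a ↦ hx (by
          simp only [RingHom.id_apply, smul_comm x c, hw, map_smul, smul_sub, smul_comm r c]) }
    rw [show g = r • LinearMap.id + x • w' from LinearMap.ext fun v ↦ by simp [w', hw]]
    exact Submodule.add_mem_sup (Submodule.smul_mem _ _ (Submodule.mem_span_singleton_self _))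
      (Submodule.smul_mem_smul hxm trivial)
  have := Submodule.le_of_le_smul_of_le_jacobson_bot Module.Finite.fg_top
    (maximalIdeal_le_jacobson _) hN
  obtain ⟨r, hr⟩ := Submodule.mem_span_singleton.mp (this (trivial : g ∈ ⊤))
  exact ⟨r, hr.symm⟩

lemma exists_eq_smul_id_of_isDualizingAt {J : Ideal R} (hJm : J ≤ maximalIdeal R)
    (hJ : ∀ q : Ideal R, q.IsPrime → J ≤ q → q = maximalIdeal R)
    (hlen : Module.length R (R ⧸ J) ≠ ⊤) (rs : List R) (hrs : ∀ r ∈ rs, r ∈ J)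
    (V : Type) [AddCommGroup V] [Module R V] [Module.Finite R V] (hV : IsWeaklyRegular V rs)
    (hJV : J ≤ Module.annihilator R V ⊔ Ideal.ofList rs) (h : IsDualizingAt J V rs.length)
    (g : V →ₗ[R] V) : ∃ r : R, g = r • LinearMap.id := by
  induction rs generalizing V with
  | nil => exact exists_eq_smul_id_of_isDualizingAt_zero hJ hlen h (by simpa using hJV) g
  | cons x rs ih =>
    have hxJ : x ∈ J := hrs x (by simp)
    obtain ⟨hx, hV⟩ := (isWeaklyRegular_cons_iff V x rs).mp hV
    refine exists_eq_smul_id_of_quotSMulTop (hJm hxJ) hx (fun g ↦ ih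
      (fun r hr ↦ hrs r (by simp [hr])) (QuotSMulTop x V) hV (hJV.trans ?_)
      (h.quotSMulTop hJm hxJ hx) g) g
    rw [Ideal.ofList_cons]
    refine sup_le ?_ (sup_le ?_ le_sup_right)
    · exact ((Submodule.mkQ _).annihilator_le_of_surjective
        (Submodule.mkQ_surjective (x • ⊤ : Submodule R V))).trans le_sup_left
    · rw [Ideal.span_singleton_le_iff_mem]
      exact Ideal.mem_sup_left (QuotSMulTop.mem_annihilator V x)

lemma annihilator_le_of_isDualizingAt {J : Ideal R} (hJm : J ≤ maximalIdeal R)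
    (rs : List R) (hrs : ∀ r ∈ rs, r ∈ J) (V : Type) [AddCommGroup V] [Module R V]
    (hV : IsWeaklyRegular V rs) (I : Ideal R) (hI : I ≤ Module.annihilator R V)
    (hJ : J = I ⊔ Ideal.ofList rs) (h : IsDualizingAt J V rs.length) :
    Module.annihilator R V ≤ I := by
  induction rs generalizing V I with
  | nil =>
    obtain rfl : J = I := by simpa using hJ
    intro r hr
    by_contra hrJ
    obtain ⟨f, hf⟩ := exists_linearMap_apply_ne_zero h (R ⧸ J)
      (Ideal.annihilator_quotient (I := J)).ge (x := Ideal.Quotient.mk J r)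
      (by rwa [Ne, Ideal.Quotient.eq_zero_iff_mem])
    refine hf ?_
    have : Ideal.Quotient.mk J r = r • (1 : R ⧸ J) := by
      rw [Algebra.smul_def, mul_one]; rfl
    rw [this, map_smul]
    exact Module.mem_annihilator.mp hr (f 1)
  | cons x rs ih =>
    have hxJ : x ∈ J := hrs x (by simp)
    obtain ⟨hx, hV⟩ := (isWeaklyRegular_cons_iff V x rs).mp hV
    have hle : Module.annihilator R V ≤ Module.annihilator R (QuotSMulTop x V) :=
      (Submodule.mkQ _).annihilator_le_of_surjective
        (Submodule.mkQ_surjective (x • ⊤ : Submodule R V))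
    have key := ih (fun r hr ↦ hrs r (by simp [hr])) (QuotSMulTop x V) hV (I ⊔ Ideal.span {x})
      (sup_le (hI.trans hle) (by
        rw [Ideal.span_singleton_le_iff_mem]; exact QuotSMulTop.mem_annihilator V x))
      (by rw [hJ, Ideal.ofList_cons, sup_assoc]) (h.quotSMulTop hJm hxJ hx)
    refine Submodule.le_of_le_smul_of_le_jacobson_bot (IsNoetherian.noetherian _)
      (maximalIdeal_le_jacobson ⊥) fun r hr ↦ ?_
    obtain ⟨i, hi, y, hy, rfl⟩ := Submodule.mem_sup.mp (key (hle hr))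
    obtain ⟨y, rfl⟩ := Ideal.mem_span_singleton'.mp hy
    refine Submodule.add_mem_sup hi ?_
    rw [mul_comm, ← smul_eq_mul]
    refine Submodule.smul_mem_smul (hJm hxJ) (Module.mem_annihilator.mpr fun v ↦ hx ?_)
    have h₁ := Module.mem_annihilator.mp hr v
    rw [add_smul, Module.mem_annihilator.mp (hI hi) v, zero_add, mul_comm, mul_smul] at h₁
    simpa using h₁

omit [IsLocalRing R] [IsNoetherianRing R] in
lemma isWeaklyRegular_of_retract (rs : List R) {V P : Type} [AddCommGroup V] [Module R V]
    [AddCommGroup P] [Module R P] (i : V →ₗ[R] P) (r : P →ₗ[R] V) (h : r ∘ₗ i = LinearMap.id)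
    (hP : IsWeaklyRegular P rs) : IsWeaklyRegular V rs := by
  induction rs generalizing V P with
  | nil => exact .nil R V
  | cons x rs ih =>
    rw [isWeaklyRegular_cons_iff] at hP ⊢
    have hi : Function.Injective i := Function.LeftInverse.injective (LinearMap.congr_fun h)
    refine ⟨fun a b hab ↦ hi (hP.1 ?_), ih (QuotSMulTop.map x i) (QuotSMulTop.map x r) ?_ hP.2⟩
    · simpa using congrArg i hab
    · rw [← QuotSMulTop.map_comp, h, QuotSMulTop.map_id]

lemma exists_regular_sequence (d : ℕ) {ω : Type} [AddCommGroup ω] [Module R ω]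
    [Module.Finite R ω] (hR : ∀ i < d, Subsingleton (E R (ResidueField R) R i))
    (hω : ∀ i < d, Subsingleton (E R (ResidueField R) ω i)) :
    ∃ rs : List R, rs.length = d ∧ (∀ r ∈ rs, r ∈ maximalIdeal R) ∧ IsWeaklyRegular R rs ∧
      IsWeaklyRegular ω rs := by
  have hne : Nontrivial (R × ω) := inferInstance
  obtain ⟨rs, hlen, hrs, hreg⟩ := ModuleCat.exists_isRegular_of_exists_subsingleton_ext
    (maximalIdeal R) d (ModuleCat.of R (R × ω)) (by
      refine lt_top_iff_ne_top.mpr fun h ↦ ?_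
      have := Submodule.eq_bot_of_le_smul_of_le_jacobson_bot (maximalIdeal R)
        (⊤ : Submodule R (R × ω)) Module.Finite.fg_top h.ge (maximalIdeal_le_jacobson _)
      exact top_ne_bot this)
    (ModuleCat.of R (ResidueField R)) (by
      change Module.support R (R ⧸ maximalIdeal R) = _
      rw [Module.support_eq_zeroLocus, Ideal.annihilator_quotient]) (fun i hi ↦ by
      have h₁ := hR i hi
      have h₂ := hω i hi
      refine subsingleton_of_forall_eq 0 fun e ↦ ?_
      have hex := post_exact₂ (f := LinearMap.inl R R ω) (g := LinearMap.snd R R ω)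
        LinearMap.inl_injective LinearMap.snd_surjective .inl_snd (ResidueField R) i
      obtain ⟨e', rfl⟩ := (hex e).mp (Subsingleton.elim _ _)
      rw [Subsingleton.elim e' 0, map_zero])
  exact ⟨rs, hlen, hrs,
    isWeaklyRegular_of_retract rs (LinearMap.inl R R ω) (LinearMap.fst R R ω) rfl hreg.1,
    isWeaklyRegular_of_retract rs (LinearMap.inr R R ω) (LinearMap.snd R R ω) rfl hreg.1⟩

/-- The data defining a canonical module of a Cohen-Macaulay local ring of dimension `d`. -/
structure IsCanonical (R : Type) [CommRing R] [IsLocalRing R] (d : ℕ) (ω : Type)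
    [AddCommGroup ω] [Module R ω] : Prop where
  dim : ringKrullDim R = d
  depth : ∀ i < d, Subsingleton (E R (ResidueField R) R i)
  ext : ∀ i ≠ d, Subsingleton (E R (ResidueField R) ω i)
  equiv : Nonempty (E R (ResidueField R) ω d ≃ₗ[R] ResidueField R)

namespace IsCanonical

variable {d : ℕ} {ω : Type} [AddCommGroup ω] [Module R ω]

omit [IsNoetherianRing R] in
lemma nontrivial (h : IsCanonical R d ω) : Nontrivial ω := by
  by_contra hcon
  rw [not_nontrivial_iff_subsingleton] at hcon
  have : Subsingleton (E R (ResidueField R) ω d) := subsingleton_of_forall_eq 0 fun e ↦ by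
    rw [← one_smul R e, ← post_smul_id, Subsingleton.elim ((1 : R) • LinearMap.id) 0, post_zero]
  exact not_subsingleton _ h.equiv.some.symm.subsingleton

variable [Module.Finite R ω]

lemma exists_isDualizingAt (h : IsCanonical R d ω) :
    ∃ rs : List R, (∀ r ∈ rs, r ∈ maximalIdeal R) ∧ IsWeaklyRegular ω rs ∧
      (∀ q : Ideal R, q.IsPrime → Ideal.ofList rs ≤ q → q = maximalIdeal R) ∧
      Module.length R (R ⧸ Ideal.ofList rs) ≠ ⊤ ∧
      IsDualizingAt (Ideal.ofList rs) ω rs.length := by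
  obtain ⟨rs, hlen, hrs, hregR, hregω⟩ :=
    exists_regular_sequence d h.depth fun i hi ↦ h.ext i hi.ne
  have hreg : IsRegular R rs :=
    (IsLocalRing.isRegular_iff_isWeaklyRegular_of_subset_maximalIdeal hrs).mpr hregR
  have hJm : Ideal.ofList rs ≤ maximalIdeal R := Ideal.span_le.mpr hrs
  have := h.nontrivial
  have hdim0 : ringKrullDim (R ⧸ Ideal.ofList rs) = 0 := by
    have := ringKrullDim_add_length_eq_ringKrullDim_of_isRegular rs hreg
    rw [hlen, h.dim] at this
    exact (ENat.WithBot.add_natCast_cancel (c := d)).mp (this.trans (zero_add _).symm)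
  have : Nontrivial (R ⧸ Ideal.ofList rs) :=
    Ideal.Quotient.nontrivial_iff.mpr (ne_top_of_le_ne_top (Ideal.IsPrime.ne_top') hJm)
  have : Ring.KrullDimLE 0 (R ⧸ Ideal.ofList rs) :=
    ringKrullDimZero_iff_ringKrullDim_eq_zero.mpr hdim0
  have : IsArtinianRing (R ⧸ Ideal.ofList rs) :=
    IsNoetherianRing.isArtinianRing_of_krullDimLE_zero
  have : IsArtinian R (R ⧸ Ideal.ofList rs) :=
    isArtinian_of_surjective_algebraMap (R := R ⧸ Ideal.ofList rs) Ideal.Quotient.mk_surjective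
  refine ⟨rs, hrs, hregω, ?_, Module.length_ne_top, ?_, ?_, ?_⟩
  · intro q hq hle
    have hq' : (q.map (Ideal.Quotient.mk (Ideal.ofList rs))).IsPrime :=
      Ideal.map_isPrime_of_surjective Ideal.Quotient.mk_surjective (by simpa using hle)
    have hmax := Ideal.comap_isMaximal_of_surjective (Ideal.Quotient.mk (Ideal.ofList rs))
      Ideal.Quotient.mk_surjective (K := q.map (Ideal.Quotient.mk (Ideal.ofList rs)))
    rw [Ideal.comap_map_of_surjective _ Ideal.Quotient.mk_surjective, ← RingHom.ker_eq_comap_bot,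
      Ideal.mk_ker, sup_eq_left.mpr hle] at hmax
    exact eq_maximalIdeal hmax
  · intro X _ _ _ hX
    have hregω' : IsRegular ω rs :=
      (IsLocalRing.isRegular_iff_isWeaklyRegular_of_subset_maximalIdeal hrs).mpr hregω
    refine ModuleCat.subsingleton_ext_of_exists_isRegular (Ideal.ofList rs) (ModuleCat.of R X) ?_
      (ModuleCat.of R ω) (lt_top_iff_ne_top.mpr hregω'.top_ne_smul.symm) rs
      (fun r hr ↦ Ideal.subset_span hr) hregω'
    change Module.support R X ⊆ _
    rw [Module.support_eq_zeroLocus]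
    exact PrimeSpectrum.zeroLocus_anti_mono_ideal hX
  · intro A B _ _ _ _ _ _ f hf hB e
    refine (pre_exact₁ hf (Submodule.mkQ_surjective _)
      (LinearMap.exact_map_mkQ_range f) ω _ e).mp ?_
    have := subsingleton_of_residueField ω (d + 1) (fun i hi ↦ h.ext i (by lia))
      (B ⧸ LinearMap.range f) (rs.length + 1) (by lia)
    exact Subsingleton.elim _ _
  · rw [hlen]
    exact h.equiv

lemma exists_eq_smul_id (h : IsCanonical R d ω) (g : ω →ₗ[R] ω) :
    ∃ r : R, g = r • LinearMap.id := by
  obtain ⟨rs, hrs, hreg, hq, hlen, hdual⟩ := h.exists_isDualizingAt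
  exact exists_eq_smul_id_of_isDualizingAt (Ideal.span_le.mpr hrs) hq hlen rs
    (fun r hr ↦ Ideal.subset_span hr) ω hreg le_sup_right hdual g

lemma annihilator_eq_bot (h : IsCanonical R d ω) : Module.annihilator R ω = ⊥ := by
  obtain ⟨rs, hrs, hreg, -, -, hdual⟩ := h.exists_isDualizingAt
  exact le_bot_iff.mp (annihilator_le_of_isDualizingAt (Ideal.span_le.mpr hrs) rs
    (fun r hr ↦ Ideal.subset_span hr) ω hreg ⊥ bot_le (bot_sup_eq _).symm hdual)

end IsCanonical

end ModExt

namespace ModExt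

open RingTheory.Sequence
open scoped Pointwise

variable {R : Type} [CommRing R] [IsNoetherianRing R]

/-- If `x` is a nonzerodivisor on `V` and `q` is associated to `V`, the minimal primes over
`q + (x)` are associated to `V ⧸ xV`. -/
lemma mem_associatedPrimes_quotSMulTop {p q : Ideal R} {V : Type} [AddCommGroup V] [Module R V]
    [Module.Finite R V] {x : R} (hx : IsSMulRegular V x) (hq : q ∈ associatedPrimes R V)
    (hp : p ∈ (q ⊔ Ideal.span {x}).minimalPrimes) : p ∈ associatedPrimes R (QuotSMulTop x V) := by
  obtain ⟨y, hy⟩ := exists_ker_toSpanSingleton hq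
  let N := Submodule.torsionBySet R V (q : Set R)
  have mem_N (v : V) : v ∈ N ↔ ∀ a ∈ q, a • v = 0 := by
    simp [N, Submodule.mem_torsionBySet_iff]
  have hann : Module.annihilator R N = q := by
    refine le_antisymm (fun r hr ↦ (hy r).mp ?_) fun a ha ↦ ?_
    · exact congrArg Subtype.val
        (Module.mem_annihilator.mp hr ⟨y, (mem_N y).mpr fun a ha ↦ (hy a).mpr ha⟩)
    · exact Module.mem_annihilator.mpr fun n ↦ Subtype.ext ((mem_N n).mp n.2 a ha)
  have hinj : Function.Injective (QuotSMulTop.map x N.subtype) := by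
    rw [← LinearMap.ker_eq_bot, LinearMap.ker_eq_bot']
    intro n hn
    obtain ⟨n, rfl⟩ := Submodule.Quotient.mk_surjective _ n
    rw [QuotSMulTop.map_apply_mk, Submodule.Quotient.mk_eq_zero,
      Submodule.mem_smul_pointwise_iff_exists] at hn
    obtain ⟨v, -, hv⟩ := hn
    rw [Submodule.Quotient.mk_eq_zero, Submodule.mem_smul_pointwise_iff_exists]
    refine ⟨⟨v, (mem_N v).mpr fun a ha ↦ hx ?_⟩, trivial, Subtype.ext hv⟩
    change x • a • v = x • (0 : V)
    rw [smul_comm, hv, smul_zero]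
    exact (mem_N n).mp n.2 a ha
  have hle (P : Ideal R) (hP : P.IsPrime) :
      Module.annihilator R (QuotSMulTop x N) ≤ P ↔ q ⊔ Ideal.span {x} ≤ P := by
    rw [← Module.mem_support_iff_of_finite (p := ⟨P, hP⟩), Module.support_quotSMulTop,
      Set.mem_inter_iff, Module.mem_support_iff_of_finite, hann, sup_le_iff, Ideal.span_le]
    rfl
  refine associatedPrimes.subset_of_injective hinj
    (Module.associatedPrimes.minimalPrimes_annihilator_subset_associatedPrimes R _ ?_)
  have hpp := hp.1.1
  refine ⟨⟨hpp, (hle p hpp).mpr hp.1.2⟩, fun P hP hPp ↦ ?_⟩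
  exact hp.2 ⟨hP.1, (hle P hP.1).mp hP.2⟩ hPp

variable [IsLocalRing R]

lemma length_le_coheight (rs : List R) (hrs : ∀ r ∈ rs, r ∈ maximalIdeal R) (V : Type)
    [AddCommGroup V] [Module R V] [Module.Finite R V] (hreg : IsWeaklyRegular V rs)
    (p : PrimeSpectrum R) (hp : p.asIdeal ∈ associatedPrimes R V) :
    (rs.length : ℕ∞) ≤ Order.coheight p := by
  induction rs generalizing V p with
  | nil => simp
  | cons x rs ih =>
    obtain ⟨hx, hreg⟩ := (isWeaklyRegular_cons_iff V x rs).mp hreg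
    obtain ⟨q, hq, -⟩ := Ideal.exists_minimalPrimes_le (I := p.asIdeal ⊔ Ideal.span {x})
      (J := maximalIdeal R) (sup_le (le_maximalIdeal p.2.ne_top) (by
        simpa [Ideal.span_le] using hrs x (by simp)))
    have hqp : q.IsPrime := hq.1.1
    have := ih (fun r hr ↦ hrs r (by simp [hr])) (QuotSMulTop x V) hreg ⟨q, hqp⟩
      (mem_associatedPrimes_quotSMulTop hx hp hq)
    refine le_trans ?_ (Order.coheight_add_one_le (a := (⟨q, hqp⟩ : PrimeSpectrum R)) ?_)
    · rw [List.length_cons, Nat.cast_succ]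
      gcongr
    · refine lt_of_le_of_ne (le_sup_left.trans hq.1.2) fun h ↦ ?_
      have hxp : x ∈ p.asIdeal := by
        rw [h]
        exact hq.1.2 (Ideal.mem_sup_right (Ideal.mem_span_singleton_self x))
      have := (biUnion_associatedPrimes_eq_compl_regular R V).le (Set.mem_biUnion hp hxp)
      exact this hx

namespace IsCanonical

variable {d : ℕ} {ω : Type} [AddCommGroup ω] [Module R ω] [Module.Finite R ω]

lemma eq_of_le_of_mem_associatedPrimes (h : IsCanonical R d ω) {p q : Ideal R} (hq : q.IsPrime)
    (hp : p ∈ associatedPrimes R R ∨ p ∈ associatedPrimes R ω) (hqp : q ≤ p) : q = p := by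
  obtain ⟨rs, hlen, hrs, hregR, hregω⟩ :=
    exists_regular_sequence d h.depth fun i hi ↦ h.ext i hi.ne
  have hpp : p.IsPrime := hp.elim (fun h ↦ h.1) fun h ↦ h.1
  have hd : (d : ℕ∞) ≤ Order.coheight (⟨p, hpp⟩ : PrimeSpectrum R) := by
    rw [← hlen]
    exact hp.elim (length_le_coheight rs hrs R hregR ⟨p, hpp⟩)
      (length_le_coheight rs hrs ω hregω ⟨p, hpp⟩)
  by_contra hne
  have h₁ := Order.coheight_add_one_le (a := (⟨p, hpp⟩ : PrimeSpectrum R)) (b := ⟨q, hq⟩)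
    (lt_of_le_of_ne hqp fun h ↦ hne (congrArg PrimeSpectrum.asIdeal h))
  have h₂ := Order.coheight_le_krullDim (⟨q, hq⟩ : PrimeSpectrum R)
  rw [show Order.krullDim (PrimeSpectrum R) = (d : ℕ∞) from h.dim, WithBot.coe_le_coe] at h₂
  have h₃ : ((d + 1 : ℕ) : ℕ∞) ≤ d := by
    push_cast
    exact (add_le_add_left hd 1).trans (h₁.trans h₂)
  exact absurd (Nat.cast_le.mp h₃) (by lia)

lemma associatedPrimes_eq (h : IsCanonical R d ω) :
    associatedPrimes R R = associatedPrimes R ω := by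
  have key (V : Type) [AddCommGroup V] [Module R V] [Module.Finite R V]
      (hV : Module.annihilator R V = ⊥) (p : Ideal R)
      (hp : p ∈ associatedPrimes R R ∨ p ∈ associatedPrimes R ω) : p ∈ associatedPrimes R V := by
    refine Module.associatedPrimes.minimalPrimes_annihilator_subset_associatedPrimes R V ?_
    rw [hV]
    refine ⟨⟨hp.elim (fun h ↦ h.1) fun h ↦ h.1, bot_le⟩, fun q hq hqp ↦ ?_⟩
    exact (h.eq_of_le_of_mem_associatedPrimes hq.1 hp hqp).ge
  ext p
  exact ⟨fun hp ↦ key ω h.annihilator_eq_bot p (.inl hp), fun hp ↦ key R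
    (Module.annihilator_eq_bot.mpr inferInstance) p (.inr hp)⟩

lemma isSMulRegular (h : IsCanonical R d ω) {x : R} (hx : IsSMulRegular R x) :
    IsSMulRegular ω x := by
  by_contra hcon
  have := (biUnion_associatedPrimes_eq_compl_regular R ω).ge hcon
  rw [← h.associatedPrimes_eq, biUnion_associatedPrimes_eq_compl_regular] at this
  exact this hx

lemma exists_isSMulRegular_mem (h : IsCanonical R d ω) {p : Ideal R} [p.IsPrime]
    (hp : p ∉ associatedPrimes R R) : ∃ x ∈ p, IsSMulRegular R x := by
  by_contra! hcon
  have hsub : (p : Set R) ⊆ ⋃ i ∈ ((associatedPrimes.finite R R).toFinset : Set (Ideal R)),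
      (id i : Ideal R) := by
    simp only [id, Set.Finite.coe_toFinset]
    rw [biUnion_associatedPrimes_eq_compl_regular]
    exact hcon
  obtain ⟨q, hq, hpq⟩ := (Ideal.subset_union_prime ⊥ ⊥ fun q hq _ _ ↦
    ((Set.Finite.mem_toFinset _).mp hq).1).mp hsub
  rw [Set.Finite.mem_toFinset] at hq
  exact hp (h.eq_of_le_of_mem_associatedPrimes ‹_› (.inl hq) hpq ▸ hq)

lemma subsingleton (h : IsCanonical R d ω) (X : Type) [AddCommGroup X] [Module R X]
    [Module.Finite R X] (i : ℕ) (hi : d + 1 ≤ i) : Subsingleton (E R X ω i) :=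
  subsingleton_of_residueField ω (d + 1) (fun i hi ↦ h.ext i (by lia)) X i hi

lemma vanishesAt_of_mem_associatedPrimes (h : IsCanonical R d ω) {p : Ideal R} [p.IsPrime]
    (hp : p ∈ associatedPrimes R R) (X : Type) [AddCommGroup X] [Module R X]
    [Module.Finite R X] (i : ℕ) (hi : 1 ≤ i) : VanishesAt p (E R X ω i) := by
  refine vanishesAt_of_associatedPrime p ω hp 1 (d + 1) (fun i hi ↦ ?_)
    (fun X _ _ _ i hi ↦ .of_subsingleton (h.subsingleton X i hi)) X i hi
  obtain ⟨i, rfl⟩ := Nat.exists_eq_add_of_le' hi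
  exact .of_subsingleton (subsingleton_of_projective i)

lemma vanishesAt_of_mem_associatedPrimes_quotSMulTop (h : IsCanonical R d ω) {p : Ideal R}
    [p.IsPrime] {x : R} (hx : IsSMulRegular R x) (hp : p ∈ associatedPrimes R (QuotSMulTop x R))
    (X : Type) [AddCommGroup X] [Module R X]
    [Module.Finite R X] (i : ℕ) (hi : 2 ≤ i) : VanishesAt p (E R X ω i) := by
  refine vanishesAt_of_associatedPrime p ω hp 2 (d + 1) (fun i hi ↦ ?_)
    (fun X _ _ _ i hi ↦ .of_subsingleton (h.subsingleton X i hi)) X i hi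
  obtain ⟨i, rfl⟩ := Nat.exists_eq_add_of_le' hi
  exact .of_exact (pre_exact₃ (injective_smul_id hx) (Submodule.mkQ_surjective _)
    (exact_smul_id_mkQ x R) ω (i + 1)) (.of_subsingleton (subsingleton_of_projective i))
    (.of_subsingleton (subsingleton_of_projective (i + 1)))

end IsCanonical

end ModExt

namespace ModExt

open RingTheory.Sequence
open scoped Pointwise

variable {R : Type} [CommRing R] [IsNoetherianRing R] [IsLocalRing R]

lemma exists_pow_smul_eq_zero {V : Type} [AddCommGroup V] [Module R V] [Module.Finite R V]
    (hV : ∀ p ∈ associatedPrimes R V, p = maximalIdeal R) :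
    ∃ t : ℕ, ∀ a ∈ maximalIdeal R ^ t, ∀ v : V, a • v = 0 := by
  have hle : maximalIdeal R ≤ (Module.annihilator R V).radical := by
    rw [← Ideal.sInf_minimalPrimes]
    exact le_sInf fun p hp ↦ (hV p
      (Module.associatedPrimes.minimalPrimes_annihilator_subset_associatedPrimes R V hp)).ge
  obtain ⟨t, ht⟩ := Ideal.exists_pow_le_of_le_radical_of_fg hle (IsNoetherian.noetherian _)
  exact ⟨t, fun a ha v ↦ Module.mem_annihilator.mp (ht ha) v⟩

omit [IsNoetherianRing R] in
lemma mem_mTorsion_iff {M : Type} [AddCommGroup M] [Module R M] (y : M) :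
    y ∈ mTorsion R M ↔ ∃ t : ℕ, ∀ a ∈ maximalIdeal R ^ t, a • y = 0 := by
  have hmono : Monotone fun n : ℕ ↦
      Submodule.torsionBySet R M ((maximalIdeal R ^ n : Ideal R) : Set R) := fun m n hmn y hy ↦
    (Submodule.mem_torsionBySet_iff _ _).mpr fun a ↦
      (Submodule.mem_torsionBySet_iff _ _).mp hy ⟨a, Ideal.pow_le_pow_right hmn a.2⟩
  rw [mTorsion, Submodule.mem_iSup_of_directed _ hmono.directed_le]
  simp [Submodule.mem_torsionBySet_iff]

namespace IsCanonical

variable {d : ℕ} {ω : Type} [AddCommGroup ω] [Module R ω] [Module.Finite R ω]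

omit [Module.Finite R ω] in
lemma maximalIdeal_notMem (h : IsCanonical R d ω) (hd : 0 < d) :
    maximalIdeal R ∉ associatedPrimes R R := fun hm ↦ by
  obtain ⟨f, hf⟩ := exists_injective_of_mem_associatedPrimes hm
  have := h.depth 0 hd
  have hf0 : f = 0 := (zeroEquiv (ResidueField R) R).injective (this.elim _ _)
  have : Nontrivial (R ⧸ maximalIdeal R) :=
    Ideal.Quotient.nontrivial_iff.mpr Ideal.IsPrime.ne_top'
  exact one_ne_zero (hf (by simp [hf0] : f 1 = f 0))

variable {M : Type} [AddCommGroup M] [Module R M]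

omit [Module.Finite R ω] [IsNoetherianRing R] [IsLocalRing R] in
lemma evMap_apply (m : M) (f : M →ₗ[R] ω) : evMap R M ω m f = f m := rfl

variable [Module.Finite R M]

lemma exists_pow_smul_eq_zero_of_evMap_eq_zero (h : IsCanonical R d ω)
    (hAss : associatedPrimes R M ⊆ associatedPrimes R R ∪ {maximalIdeal R}) :
    ∃ t : ℕ, ∀ a ∈ maximalIdeal R ^ t, ∀ m, evMap R M ω m = 0 → a • m = 0 := by
  obtain ⟨t, ht⟩ := exists_pow_smul_eq_zero (R := R)
      (V := LinearMap.ker (evMap R M ω)) fun p hp ↦ by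
    have hpp : p.IsPrime := hp.1
    obtain ⟨⟨y, hyker⟩, hy⟩ := exists_ker_toSpanSingleton hp
    have hy (r : R) : r • y = 0 ↔ r ∈ p := by
      rw [← hy, ← Subtype.coe_inj]
      rfl
    refine (hAss (mem_associatedPrimes_of_smul_eq_zero_iff hpp hy)).resolve_left fun hpR ↦ ?_
    obtain ⟨j, hj⟩ := exists_injective_of_mem_associatedPrimes (h.associatedPrimes_eq ▸ hpR)
    let i : (R ⧸ p) →ₗ[R] M :=
      Submodule.liftQ p (LinearMap.toSpanSingleton R M y) fun r hr ↦ (hy r).mpr hr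
    have hi : Function.Injective i :=
      LinearMap.ker_eq_bot.mp (Submodule.ker_liftQ_eq_bot _ _ _ fun r hr ↦ (hy r).mp hr)
    obtain ⟨s, hs, hs0⟩ := h.vanishesAt_of_mem_associatedPrimes hpR
      (M ⧸ LinearMap.range i) 1 le_rfl
    obtain ⟨e, he⟩ := (pre_exact₁ hi (Submodule.mkQ_surjective _)
      (LinearMap.exact_map_mkQ_range i) ω 0 (zeroEquiv _ _ (s • j))).mp (by
        rw [map_smul, map_smul, hs0])
    obtain ⟨g, rfl⟩ := (zeroEquiv _ _).surjective e
    rw [pre_zeroEquiv] at he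
    have hg := LinearMap.congr_fun ((zeroEquiv _ _).injective he) (Submodule.Quotient.mk 1)
    have hiy : i (Submodule.Quotient.mk 1) = y :=
      (Submodule.liftQ_apply _ _ _).trans (one_smul R y)
    rw [LinearMap.comp_apply, hiy, ← evMap_apply y g, LinearMap.mem_ker.mp hyker,
      LinearMap.zero_apply, LinearMap.smul_apply, ← map_smul, ← Submodule.Quotient.mk_smul] at hg
    have := hj (hg.symm.trans (map_zero j).symm)
    rw [Submodule.Quotient.mk_eq_zero, smul_eq_mul, mul_one] at this
    exact hs this
  exact ⟨t, fun a ha y hy ↦ congrArg Subtype.val (ht a ha ⟨y, hy⟩)⟩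

lemma ker_evMap (h : IsCanonical R d ω) (hd : 0 < d)
    (hAss : associatedPrimes R M ⊆ associatedPrimes R R ∪ {maximalIdeal R}) :
    LinearMap.ker (evMap R M ω) = mTorsion R M := by
  refine le_antisymm (fun y hy ↦ ?_) fun y hy ↦ ?_
  · obtain ⟨t, ht⟩ := h.exists_pow_smul_eq_zero_of_evMap_eq_zero hAss
    exact (mem_mTorsion_iff y).mpr ⟨t, fun a ha ↦ ht a ha y hy⟩
  · obtain ⟨t, ht⟩ := (mem_mTorsion_iff y).mp hy
    obtain ⟨x, hxm, hx⟩ := h.exists_isSMulRegular_mem (h.maximalIdeal_notMem hd)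
    refine LinearMap.mem_ker.mpr (LinearMap.ext fun f ↦ ?_)
    refine ((h.isSMulRegular hx).pow t) ?_
    change x ^ t • f y = x ^ t • (0 : ω)
    rw [← map_smul, ht _ (Ideal.pow_mem_pow hxm t), map_zero, smul_zero]

omit [Module.Finite R ω] [IsNoetherianRing R] [IsLocalRing R] in
lemma _root_.IsSMulRegular.linearMap {x : R} {P : Type} [AddCommGroup P] [Module R P]
    (hx : IsSMulRegular ω x) : IsSMulRegular (P →ₗ[R] ω) x := fun _ _ hfg ↦
  LinearMap.ext fun v ↦ hx (LinearMap.congr_fun hfg v)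

/-- An element of the bidual of `M` comes from `M`, up to an element outside of `p`, if `p` has
depth at most one. -/
lemma exists_smul_mem_range_evMap (h : IsCanonical R d ω) {p : Ideal R} [p.IsPrime]
    (hp : p ∈ associatedPrimes R R ∨
      ∃ x ∈ p, IsSMulRegular R x ∧ p ∈ associatedPrimes R (QuotSMulTop x R))
    (c : (M →ₗ[R] ω) →ₗ[R] ω) : ∃ s ∉ p, s • c ∈ LinearMap.range (evMap R M ω) := by
  obtain ⟨n, g, hg⟩ := Module.Finite.exists_fin' R M
  let i : (M →ₗ[R] ω) →ₗ[R] ((Fin n → R) →ₗ[R] ω) := LinearMap.lcomp R ω g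
  have hi : Function.Injective i := fun f f' hff' ↦ LinearMap.ext fun m ↦ by
    obtain ⟨v, rfl⟩ := hg m
    exact LinearMap.congr_fun hff' v
  obtain ⟨s, hs, hs0⟩ : VanishesAt p
      (E R (((Fin n → R) →ₗ[R] ω) ⧸ LinearMap.range i) ω 1) := by
    obtain hp | ⟨x, hxp, hx, hp⟩ := hp
    · exact h.vanishesAt_of_mem_associatedPrimes hp _ 1 le_rfl
    · have hreg : IsSMulRegular (((Fin n → R) →ₗ[R] ω) ⧸ LinearMap.range i) x := by
        rw [isSMulRegular_iff_right_eq_zero_of_smul]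
        intro f hf
        obtain ⟨f, rfl⟩ := Submodule.Quotient.mk_surjective _ f
        rw [← Submodule.Quotient.mk_smul, Submodule.Quotient.mk_eq_zero] at hf
        obtain ⟨l, hl⟩ := hf
        rw [Submodule.Quotient.mk_eq_zero]
        have hker : LinearMap.ker g ≤ LinearMap.ker f := fun v hv ↦ h.isSMulRegular hx (by
          change x • f v = x • (0 : ω)
          rw [smul_zero, ← LinearMap.smul_apply, ← hl]
          change l (g v) = 0
          rw [LinearMap.mem_ker.mp hv, map_zero])
        refine ⟨Submodule.liftQ _ f hker ∘ₗ (g.quotKerEquivOfSurjective hg).symm.toLinearMap,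
          LinearMap.ext fun v ↦ ?_⟩
        change Submodule.liftQ _ f hker ((g.quotKerEquivOfSurjective hg).symm (g v)) = f v
        rw [(LinearEquiv.symm_apply_eq _).mpr
          (LinearMap.quotKerEquivOfSurjective_apply_mk g hg v).symm, Submodule.liftQ_apply]
      obtain ⟨s, hs, hs0⟩ := h.vanishesAt_of_mem_associatedPrimes_quotSMulTop hx hp
        (QuotSMulTop x (((Fin n → R) →ₗ[R] ω) ⧸ LinearMap.range i)) 2 le_rfl
      refine .of_smul hs hxp fun e ↦ ?_
      obtain ⟨e', he'⟩ := (pre_exact₁ (injective_smul_id hreg) (Submodule.mkQ_surjective _)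
        (exact_smul_id_mkQ x _) ω 1 (s • e)).mp (by rw [map_smul, hs0])
      exact ⟨e', by rw [← he', pre_smul_id]⟩
  obtain ⟨e, he⟩ := (pre_exact₁ hi (Submodule.mkQ_surjective _)
    (LinearMap.exact_map_mkQ_range i) ω 0 (zeroEquiv _ _ (s • c))).mp (by
      rw [map_smul, map_smul, hs0])
  obtain ⟨c', rfl⟩ := (zeroEquiv _ _).surjective e
  rw [pre_zeroEquiv] at he
  have hc := (zeroEquiv _ _).injective he
  have key (k : Fin n) := h.exists_eq_smul_id
    (c' ∘ₗ LinearMap.smulRightₗ (LinearMap.proj k))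
  choose r hr using key
  refine ⟨s, hs, g r, LinearMap.ext fun l ↦ ?_⟩
  rw [← hc, evMap_apply]
  change l (g r) = c' (l ∘ₗ g)
  have hl : l ∘ₗ g = ∑ k, LinearMap.smulRight (LinearMap.proj k) (l (g (Pi.single k 1))) := by
    refine LinearMap.pi_ext' fun k ↦ LinearMap.ext_ring ?_
    simp [Pi.single_apply]
  rw [hl, map_sum]
  have h₁ (k : Fin n) : c' (LinearMap.smulRight (LinearMap.proj k) (l (g (Pi.single k 1)))) =
      r k • l (g (Pi.single k 1)) := LinearMap.congr_fun (hr k) _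
  simp_rw [h₁]
  conv_lhs => rw [pi_eq_sum_univ' r]
  simp [map_sum]

end IsCanonical

end ModExt

namespace ModExt

open RingTheory.Sequence
open scoped Pointwise

variable {R : Type} [CommRing R]

lemma localizedModule_mk_eq_zero_iff {S : Submonoid R} {M : Type} [AddCommGroup M] [Module R M]
    (m : M) (s : S) : LocalizedModule.mk m s = 0 ↔ ∃ u ∈ S, u • m = 0 := by
  rw [← LocalizedModule.zero_mk s, LocalizedModule.mk_eq]
  constructor
  · rintro ⟨u, hu⟩
    exact ⟨u * s, mul_mem u.2 s.2, by simpa [Submonoid.smul_def, mul_smul] using hu⟩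
  · rintro ⟨u, hu, hum⟩
    refine ⟨⟨u, hu⟩, ?_⟩
    rw [smul_zero, smul_zero, smul_comm]
    exact (congrArg (s • ·) hum).trans (smul_zero s)

/-- If `φ` is injective locally at `p` and `M_p` has no first extension by the residue field,
then an element `c` with `p c` in the range of `φ` is locally at `p` in the range of `φ`, as soon
as `p` contains a nonzerodivisor on the target. -/
lemma exists_smul_mem_range_of_subsingleton_localized {p : Ideal R} [p.IsPrime] {M N : Type}
    [AddCommGroup M] [Module R M] [AddCommGroup N] [Module R N] (φ : M →ₗ[R] N)
    (hφ : ∀ m, φ m = 0 → ∃ u ∉ p, u • m = 0)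
    (hext : Subsingleton (E (Localization.AtPrime p) (ResidueField (Localization.AtPrime p))
      (LocalizedModule p.primeCompl M) 1))
    {x : R} (hxp : x ∈ p) (hx : IsSMulRegular N x) (c : N)
    (hc : ∀ a ∈ p, a • c ∈ LinearMap.range φ) : ∃ s ∉ p, s • c ∈ LinearMap.range φ := by
  let A := Localization.AtPrime p
  let φp : LocalizedModule p.primeCompl M →ₗ[A] LocalizedModule p.primeCompl N :=
    LocalizedModule.map p.primeCompl φ
  have hinj : Function.Injective φp := by
    rw [← LinearMap.ker_eq_bot, LinearMap.ker_eq_bot']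
    intro m hm
    induction m with | _ m s
    rw [LocalizedModule.map_mk, localizedModule_mk_eq_zero_iff] at hm
    obtain ⟨u, hu, hum⟩ := hm
    obtain ⟨v, hv, hvm⟩ := hφ (u • m) (by rw [map_smul, hum])
    exact (localizedModule_mk_eq_zero_iff m s).mpr ⟨v * u, mul_mem hv hu, by rw [mul_smul, hvm]⟩
  let c₁ : LocalizedModule p.primeCompl N := LocalizedModule.mk c 1
  have hrange (a : maximalIdeal A) : (a : A) • c₁ ∈ LinearMap.range φp := by
    obtain ⟨a, ha⟩ := a
    induction a using Localization.induction_on with | _ y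
    obtain ⟨a, s⟩ := y
    have hap : a ∈ p := by
      rw [Localization.mk_eq_mk'] at ha
      exact (IsLocalization.AtPrime.mk'_mem_maximal_iff A p a s).mp ha
    obtain ⟨m, hm⟩ := hc a hap
    exact ⟨LocalizedModule.mk m s, by
      rw [LocalizedModule.map_mk, hm, LocalizedModule.mk_smul_mk, mul_one]⟩
  let h : maximalIdeal A →ₗ[A] LocalizedModule p.primeCompl M :=
    (LinearEquiv.ofInjective φp hinj).symm.toLinearMap ∘ₗ
      LinearMap.codRestrict (LinearMap.range φp)
        (LinearMap.toSpanSingleton A _ c₁ ∘ₗ (maximalIdeal A).subtype) hrange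
  have hh (a : maximalIdeal A) : φp (h a) = (a : A) • c₁ :=
    congrArg Subtype.val ((LinearEquiv.ofInjective φp hinj).apply_symm_apply
      ⟨(a : A) • c₁, hrange a⟩)
  obtain ⟨e, he⟩ := (pre_exact₁ (Submodule.subtype_injective (maximalIdeal A))
    (Submodule.mkQ_surjective _) (LinearMap.exact_subtype_mkQ (maximalIdeal A))
    (LocalizedModule p.primeCompl M) 0 (zeroEquiv _ _ h)).mp (hext.elim _ _)
  obtain ⟨g, rfl⟩ := (zeroEquiv _ _).surjective e
  rw [pre_zeroEquiv] at he
  have hg (a : maximalIdeal A) : g a = h a := LinearMap.congr_fun ((zeroEquiv _ _).injective he) a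
  have hreg : IsSMulRegular (LocalizedModule p.primeCompl N) (algebraMap R A x) :=
    hx.of_isLocalizedModule A p.primeCompl (LocalizedModule.mkLinearMap p.primeCompl N)
  have hmem : algebraMap R A x ∈ maximalIdeal A :=
    (IsLocalization.AtPrime.to_map_mem_maximal_iff A p x).mpr hxp
  have hμ : φp (g 1) = c₁ := by
    apply hreg
    change algebraMap R A x • φp (g 1) = algebraMap R A x • c₁
    rw [← hh ⟨_, hmem⟩, ← hg, ← map_smul, ← map_smul, smul_eq_mul, mul_one]
  generalize g 1 = μ at hμ
  induction μ with | _ m s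
  rw [LocalizedModule.map_mk] at hμ
  obtain ⟨u, hu⟩ := LocalizedModule.mk_eq.mp hμ
  rw [one_smul] at hu
  refine ⟨u * s, mul_mem u.2 s.2, u.1 • m, ?_⟩
  rw [map_smul, mul_smul]
  exact hu

lemma two_le_mdim_localized {p q q' : Ideal R} [p.IsPrime] (hq : q.IsPrime) (hq' : q'.IsPrime)
    (hlt : q < q') (hlt' : q' < p) {M : Type} [AddCommGroup M] [Module R M] {y : M}
    (hy : ∀ r : R, r • y = 0 ↔ r ∈ q) :
    2 ≤ mdim (Localization.AtPrime p) (LocalizedModule p.primeCompl M) := by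
  let A := Localization.AtPrime p
  let e := IsLocalization.AtPrime.primeSpectrumOrderIso A p
  let P : PrimeSpectrum A := e.symm ⟨⟨q, hq⟩, (hlt.trans hlt').le⟩
  let P' : PrimeSpectrum A := e.symm ⟨⟨q', hq'⟩, hlt'.le⟩
  let P'' : PrimeSpectrum A := e.symm ⟨⟨p, ‹_›⟩, Set.mem_Iic.mpr le_rfl⟩
  have h₁ : P < P' := e.symm.strictMono hlt
  have h₂ : P' < P'' := e.symm.strictMono hlt'
  have hP : P.asIdeal.comap (algebraMap R A) = q :=
    congrArg (fun z ↦ z.1.asIdeal) (e.apply_symm_apply ⟨⟨q, hq⟩, (hlt.trans hlt').le⟩)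
  have hann : Module.annihilator A (LocalizedModule p.primeCompl M) ≤ P.asIdeal := by
    intro a ha
    have hay := Module.mem_annihilator.mp ha (LocalizedModule.mk y 1)
    induction a using Localization.induction_on with | _ a
    rw [LocalizedModule.mk_smul_mk, localizedModule_mk_eq_zero_iff] at hay
    obtain ⟨u, hu, hua⟩ := hay
    rw [← mul_smul, hy] at hua
    have haq := (hq.mem_or_mem hua).resolve_left fun h ↦ hu ((hlt.trans hlt').le h)
    rw [← hP, Ideal.mem_comap] at haq
    rw [Localization.mk_eq_mk', IsLocalization.mk'_eq_mul_mk'_one]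
    exact Ideal.mul_mem_right _ _ haq
  let z : PrimeSpectrum.zeroLocus (R := A)
    (Module.annihilator A (LocalizedModule p.primeCompl M)) := ⟨P, hann⟩
  let z' : PrimeSpectrum.zeroLocus (R := A)
    (Module.annihilator A (LocalizedModule p.primeCompl M)) := ⟨P', hann.trans h₁.le⟩
  let z'' : PrimeSpectrum.zeroLocus (R := A)
    (Module.annihilator A (LocalizedModule p.primeCompl M)) := ⟨P'', hann.trans (h₁.trans h₂).le⟩
  rw [mdim, ringKrullDim_quotient]
  have hz : (2 : ℕ∞) ≤ Order.coheight z := by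
    have h₃ := Order.coheight_add_one_le (a := z') (b := z) h₁
    have h₄ := Order.coheight_add_one_le (a := z'') (b := z') h₂
    calc (2 : ℕ∞) = 0 + 1 + 1 := by norm_num
      _ ≤ Order.coheight z'' + 1 + 1 := by gcongr; exact zero_le
      _ ≤ Order.coheight z' + 1 := by gcongr
      _ ≤ _ := h₃
  exact (WithBot.coe_le_coe.mpr hz).trans (Order.coheight_le_krullDim z)

lemma subsingleton_of_lt_rdepth [IsLocalRing R] {N : Type} [AddCommGroup N] [Module R N] {i : ℕ}
    (h : (i : ℕ∞) < rdepth R N) : Subsingleton (E R (ResidueField R) N i) := by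
  by_contra hcon
  rw [not_subsingleton_iff_nontrivial] at hcon
  have hn : Nontrivial (extMod R (ResidueField R) N i) :=
    (extModEquiv R (ResidueField R) N i).toEquiv.nontrivial
  exact h.not_ge (sInf_le ⟨i, hn, rfl⟩)

variable [IsNoetherianRing R] [IsLocalRing R]

namespace IsCanonical

variable {d : ℕ} {ω : Type} [AddCommGroup ω] [Module R ω] [Module.Finite R ω]
variable {M : Type} [AddCommGroup M] [Module R M] [Module.Finite R M]

lemma exists_pow_smul_mem_range_evMap (h : IsCanonical R d ω) (hd : 0 < d)
    (hAss : associatedPrimes R M ⊆ associatedPrimes R R ∪ {maximalIdeal R})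
    (hS2 : serreS2Punctured R M) :
    ∃ t : ℕ, ∀ a ∈ maximalIdeal R ^ t, ∀ c, a • c ∈ LinearMap.range (evMap R M ω) := by
  obtain ⟨t, ht⟩ := exists_pow_smul_eq_zero (R := R)
    (V := ((M →ₗ[R] ω) →ₗ[R] ω) ⧸ LinearMap.range (evMap R M ω)) fun p hp ↦ by
      by_contra hpm
      have hpp : p.IsPrime := hp.1
      obtain ⟨c, hc⟩ := exists_ker_toSpanSingleton hp
      obtain ⟨c, rfl⟩ := Submodule.Quotient.mk_surjective _ c
      simp_rw [← Submodule.Quotient.mk_smul, Submodule.Quotient.mk_eq_zero] at hc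
      suffices ∃ s ∉ p, s • c ∈ LinearMap.range (evMap R M ω) by
        obtain ⟨s, hs, hsc⟩ := this
        exact hs ((hc s).mp hsc)
      by_cases hpdepth : p ∈ associatedPrimes R R ∨
        ∃ x ∈ p, IsSMulRegular R x ∧ p ∈ associatedPrimes R (QuotSMulTop x R)
      · exact h.exists_smul_mem_range_evMap hpdepth c
      push Not at hpdepth
      obtain ⟨hpR, hpx⟩ := hpdepth
      obtain ⟨x, hxp, hx⟩ := h.exists_isSMulRegular_mem hpR
      by_cases hann : Module.annihilator R M ≤ p
      · obtain ⟨q, hq, hqp⟩ := Ideal.exists_minimalPrimes_le hann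
        have hqM :=
          Module.associatedPrimes.minimalPrimes_annihilator_subset_associatedPrimes R M hq
        have hqR : q ∈ associatedPrimes R R := (hAss hqM).resolve_right fun hqm ↦
          hpm ((IsLocalRing.maximalIdeal.isMaximal R).eq_of_le hpp.ne_top
            ((Set.mem_singleton_iff.mp hqm).ge.trans hqp)).symm
        obtain ⟨q', hq', hq'p⟩ := Ideal.exists_minimalPrimes_le
          (I := q ⊔ Ideal.span {x}) (J := p) (sup_le hqp (by simpa [Ideal.span_le] using hxp))
        have hxq' : x ∈ q' := hq'.1.2 (Ideal.mem_sup_right (Ideal.mem_span_singleton_self x))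
        have hne : q' ≠ p := fun heq ↦ hpx x hxp hx
          (heq ▸ mem_associatedPrimes_quotSMulTop hx hqR hq')
        have hne' : q ≠ q' := fun heq ↦
          (biUnion_associatedPrimes_eq_compl_regular R R).le
            (Set.mem_biUnion hqR (heq ▸ hxq' : x ∈ q)) hx
        obtain ⟨y, hy⟩ := exists_ker_toSpanSingleton hqM
        have h2 := two_le_mdim_localized hqM.1 hq'.1.1
          (lt_of_le_of_ne (le_sup_left.trans hq'.1.2) hne') (lt_of_le_of_ne hq'p hne) hy
        have hdep := hS2 p hpm
        rw [min_eq_left h2] at hdep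
        refine exists_smul_mem_range_of_subsingleton_localized (evMap R M ω) (fun m hm ↦ ?_)
          (subsingleton_of_lt_rdepth (lt_of_lt_of_le (by norm_num) (WithBot.coe_le_coe.mp hdep)))
          hxp (h.isSMulRegular hx).linearMap c fun a ha ↦ (hc a).mpr ha
        have hmt : m ∈ mTorsion R M := h.ker_evMap hd hAss ▸ LinearMap.mem_ker.mpr hm
        obtain ⟨t, ht⟩ := (mem_mTorsion_iff m).mp hmt
        obtain ⟨v, hv, hvp⟩ := SetLike.not_le_iff_exists.mp fun hle ↦ hpm
          ((IsLocalRing.maximalIdeal.isMaximal R).eq_of_le hpp.ne_top hle).symm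
        exact ⟨v ^ t, fun hvt ↦ hvp (hpp.mem_of_pow_mem t hvt), ht _ (Ideal.pow_mem_pow hv t)⟩
      · obtain ⟨s, hs, hsp⟩ := SetLike.not_le_iff_exists.mp hann
        refine ⟨s, hsp, ?_⟩
        have : s • c = 0 := LinearMap.ext fun f ↦ by
          have hsf : s • f = 0 := LinearMap.ext fun m ↦ by
            rw [LinearMap.smul_apply, ← map_smul, Module.mem_annihilator.mp hs, map_zero,
              LinearMap.zero_apply]
          rw [LinearMap.smul_apply, ← map_smul, hsf, map_zero, LinearMap.zero_apply]
        rw [this]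
        exact zero_mem _
  refine ⟨t, fun a ha c ↦ ?_⟩
  have := ht a ha (Submodule.Quotient.mk c)
  rwa [← Submodule.Quotient.mk_smul, Submodule.Quotient.mk_eq_zero] at this

end IsCanonical

end ModExt

namespace ModExt

open RingTheory.Sequence
open scoped Pointwise

variable {R : Type} [CommRing R]

lemma exists_eq_smul_of_pow_smul_eq {x y : R} {V : Type} [AddCommGroup V] [Module R V]
    (hx : IsSMulRegular V x) (hy : IsSMulRegular (QuotSMulTop x V) y) (k l : ℕ) {v w : V}
    (h : y ^ l • v = x ^ k • w) : ∃ u, v = x ^ k • u := by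
  have h₁ (v w : V) (h : y • v = x • w) : ∃ u, v = x • u := by
    have : y • (Submodule.Quotient.mk v : QuotSMulTop x V) = 0 := by
      rw [← Submodule.Quotient.mk_smul, h]
      exact (Submodule.Quotient.mk_eq_zero _).mpr (Submodule.smul_mem_pointwise_smul _ _ _ trivial)
    have := hy.right_eq_zero_of_smul this
    rw [Submodule.Quotient.mk_eq_zero, Submodule.mem_smul_pointwise_iff_exists] at this
    obtain ⟨u, -, hu⟩ := this
    exact ⟨u, hu.symm⟩
  have h₂ (k : ℕ) : ∀ v w : V, y • v = x ^ k • w → ∃ u, v = x ^ k • u := by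
    induction k with
    | zero => exact fun v w _ ↦ ⟨v, by simp⟩
    | succ k ih =>
      intro v w h
      obtain ⟨u, rfl⟩ := ih v (x • w) (by rw [h, pow_succ, mul_smul])
      obtain ⟨u', rfl⟩ := h₁ u w (hx.pow k (by
        change x ^ k • y • u = x ^ k • x • w
        rw [smul_comm, h, pow_succ, mul_smul]))
      exact ⟨u', by rw [pow_succ, mul_smul]⟩
  induction l generalizing v w with
  | zero => exact ⟨w, by simpa using h⟩
  | succ l ih =>
    obtain ⟨u, hu⟩ := h₂ k (y ^ l • v) w (by rw [← mul_smul, ← pow_succ', h])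
    exact ih hu

lemma exists_linearMap_eq_smul {x : R} {P V : Type} [AddCommGroup P] [Module R P]
    [AddCommGroup V] [Module R V] (hx : IsSMulRegular V x) (F : P →ₗ[R] V)
    (h : ∀ p, ∃ u, F p = x • u) : ∃ H : P →ₗ[R] V, F = x • H := by
  choose u hu using h
  refine ⟨⟨⟨u, fun p q ↦ hx ?_⟩, fun r p ↦ hx ?_⟩, LinearMap.ext hu⟩
  · change x • u (p + q) = x • (u p + u q)
    rw [smul_add, ← hu, ← hu, ← hu, map_add]
  · change x • u (r • p) = x • r • u p
    rw [smul_comm, ← hu, ← hu, map_smul]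

section Connecting

variable (J : Ideal R) (M : Type) [AddCommGroup M] [Module R M]

/-- The connecting map `Hom(J, M) → Ext¹(R ⧸ J, M)`. -/
noncomputable def connecting : (J →ₗ[R] M) →ₗ[R] E R (R ⧸ J) M 1 :=
  preδ (Submodule.subtype_injective J) (Submodule.mkQ_surjective J)
    (LinearMap.exact_subtype_mkQ J) M 0 ∘ₗ (zeroEquiv J M).toLinearMap

lemma connecting_surjective : Function.Surjective (connecting J M) := fun e ↦ by
  obtain ⟨e', rfl⟩ := (pre_exact₃ (Submodule.subtype_injective J) (Submodule.mkQ_surjective J)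
    (LinearMap.exact_subtype_mkQ J) M 0 e).mp ((subsingleton_of_projective 0).elim _ _)
  obtain ⟨f, rfl⟩ := (zeroEquiv J M).surjective e'
  exact ⟨f, rfl⟩

variable {J M}

lemma connecting_eq_zero_iff (f : J →ₗ[R] M) :
    connecting J M f = 0 ↔ ∃ m : M, ∀ a : J, f a = (a : R) • m := by
  refine (pre_exact₁ (Submodule.subtype_injective J) (Submodule.mkQ_surjective J)
    (LinearMap.exact_subtype_mkQ J) M 0 (zeroEquiv J M f)).trans ?_
  constructor
  · rintro ⟨e, he⟩
    obtain ⟨g, rfl⟩ := (zeroEquiv R M).surjective e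
    rw [pre_zeroEquiv] at he
    refine ⟨g 1, fun a ↦ ?_⟩
    rw [← (zeroEquiv J M).injective he, ← map_smul, smul_eq_mul, mul_one]
    rfl
  · rintro ⟨m, hm⟩
    refine ⟨zeroEquiv R M (LinearMap.toSpanSingleton R M m), ?_⟩
    rw [pre_zeroEquiv]
    exact congrArg _ (LinearMap.ext fun a ↦ (hm a).symm)

lemma pre_connecting {J' : Ideal R} (h : J' ≤ J) (f : J →ₗ[R] M) :
    pre (Submodule.mapQ J' J LinearMap.id h) M 1 (connecting J M f) =
      connecting J' M (f ∘ₗ Submodule.inclusion h) := by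
  have hex (J : Ideal R) := shortExact (LinearMap.exact_subtype_mkQ J)
    (Submodule.subtype_injective J) (Submodule.mkQ_surjective J)
  have hnat := ShortComplex.ShortExact.extClass_naturality (hex J') (hex J)
    { τ₁ := ModuleCat.ofHom (Submodule.inclusion h)
      τ₂ := 𝟙 _
      τ₃ := ModuleCat.ofHom (Submodule.mapQ J' J LinearMap.id h)
      comm₁₂ := rfl
      comm₂₃ := rfl }
  change (Abelian.Ext.mk₀ (ModuleCat.ofHom (Submodule.mapQ J' J LinearMap.id h))).comp
      ((hex J).extClass.comp (zeroEquiv J M f) (add_zero 1)) (zero_add 1) =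
    (hex J').extClass.comp (zeroEquiv J' M (f ∘ₗ Submodule.inclusion h)) (add_zero 1)
  refine (Abelian.Ext.comp_assoc _ _ _ (zero_add 1) (add_zero 1) (by lia)).symm.trans <|
    (congrArg (fun t ↦ t.comp (zeroEquiv J M f) (add_zero 1)) hnat.symm).trans <|
    (Abelian.Ext.comp_assoc _ _ _ (add_zero 1) (zero_add 0) (by lia)).trans ?_
  rw [← pre_zeroEquiv]
  rfl

end Connecting

variable {M N : Type} [AddCommGroup M] [Module R M] [AddCommGroup N] [Module R N]

/-- If `N = Hom(J, N)`, a map `φ : M → N` induces a map `Ext¹(R ⧸ J, M) → coker φ`. -/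
lemma exists_ext_one_to_coker {J : Ideal R} (φ : M →ₗ[R] N)
    (hinj : ∀ n : N, (∀ a ∈ J, a • n = 0) → n = 0)
    (hsurj : ∀ f : J →ₗ[R] N, ∃ n, ∀ a : J, f a = (a : R) • n) :
    ∃ ψ : E R (R ⧸ J) M 1 →ₗ[R] N ⧸ LinearMap.range φ,
      ∀ (f : J →ₗ[R] M) (n : N), (∀ a : J, φ (f a) = (a : R) • n) →
        ψ (connecting J M f) = Submodule.Quotient.mk n := by
  let b : N →ₗ[R] J →ₗ[R] N :=
    LinearMap.lcomp R N J.subtype ∘ₗ (LinearMap.ringLmapEquivSelf R R N).symm.toLinearMap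
  have hb (n : N) (a : J) : b n a = (a : R) • n := rfl
  have hbij : Function.Bijective b := by
    refine ⟨?_, fun f ↦ ?_⟩
    · rw [← LinearMap.ker_eq_bot, LinearMap.ker_eq_bot']
      exact fun n hn ↦ hinj n fun a ha ↦ LinearMap.congr_fun hn ⟨a, ha⟩
    · obtain ⟨n, hn⟩ := hsurj f
      exact ⟨n, LinearMap.ext fun a ↦ (hn a).symm⟩
  let B := LinearEquiv.ofBijective b hbij
  have hB (f : J →ₗ[R] M) (n : N) (h : ∀ a : J, φ (f a) = (a : R) • n) :
      B.symm (φ ∘ₗ f) = n := by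
    rw [LinearEquiv.symm_apply_eq]
    exact LinearMap.ext h
  let θ : (J →ₗ[R] M) →ₗ[R] N ⧸ LinearMap.range φ :=
    Submodule.mkQ _ ∘ₗ B.symm.toLinearMap ∘ₗ LinearMap.compRight R φ
  have hθ (f : J →ₗ[R] M) (n : N) (h : ∀ a : J, φ (f a) = (a : R) • n) :
      θ f = Submodule.Quotient.mk n := congrArg Submodule.Quotient.mk (hB f n h)
  have hker : LinearMap.ker (connecting J M) ≤ LinearMap.ker θ := fun f hf ↦ by
    obtain ⟨m, hm⟩ := (connecting_eq_zero_iff f).mp hf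
    rw [LinearMap.mem_ker, hθ f (φ m) fun a ↦ by rw [hm, map_smul]]
    exact (Submodule.Quotient.mk_eq_zero _).mpr ⟨m, rfl⟩
  let Q := (connecting J M).quotKerEquivOfSurjective (connecting_surjective J M)
  refine ⟨Submodule.liftQ _ θ hker ∘ₗ Q.symm.toLinearMap, fun f n h ↦ ?_⟩
  change Submodule.liftQ _ θ hker (Q.symm (connecting J M f)) = _
  rw [(LinearEquiv.symm_apply_eq _).mpr
    (LinearMap.quotKerEquivOfSurjective_apply_mk _ (connecting_surjective J M) f).symm,
    Submodule.liftQ_apply, hθ f n h]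

/-- An element of `N` that is multiplied into the range of `φ` by a power of `I` comes from a
linear map from a power of `I` to `M`, by the Artin-Rees lemma. -/
lemma exists_linearMap_pow_of_smul_mem_range [IsNoetherianRing R] [Module.Finite R M]
    (I : Ideal R) (φ : M →ₗ[R] N) {s : ℕ} (hker : ∀ a ∈ I ^ s, ∀ m, φ m = 0 → a • m = 0)
    {t : ℕ} {c : N} (hc : ∀ a ∈ I ^ t, a • c ∈ LinearMap.range φ) :
    ∃ (t' : ℕ) (f : (I ^ t' : Ideal R) →ₗ[R] M), ∀ a, φ (f a) = (a : R) • c := by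
  let G : Submodule R (R × M) := LinearMap.ker
    (φ ∘ₗ LinearMap.snd R R M - LinearMap.toSpanSingleton R N c ∘ₗ LinearMap.fst R R M)
  have hG (z : R × M) : z ∈ G ↔ φ z.2 = z.1 • c := by
    simp [G, sub_eq_zero]
  let π : G →ₗ[R] R := LinearMap.fst R R M ∘ₗ G.subtype
  obtain ⟨k, hk⟩ := I.exists_pow_inf_eq_pow_smul (LinearMap.ker π)
  let H : Submodule R G := I ^ (k + s) • ⊤
  have hzero (z : G) (hzH : z ∈ H) (hz : π z = 0) : z = 0 := by
    have hz' : z ∈ I ^ s • (I ^ k • ⊤ ⊓ LinearMap.ker π) := by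
      have := hk (k + s) (by lia)
      rw [Nat.add_sub_cancel_left] at this
      rw [← this]
      exact ⟨hzH, hz⟩
    have hle : I ^ s • (I ^ k • ⊤ ⊓ LinearMap.ker π) ≤ (⊥ : Submodule R G) := by
      refine Submodule.smul_le.mpr fun a ha w hw ↦ ?_
      have hw1 : w.1.1 = 0 := hw.2
      have hw2 : a • w.1.2 = 0 := hker a ha _ (by rw [(hG w.1).mp w.2, hw1, zero_smul])
      refine (Submodule.mem_bot R).mpr (Subtype.ext (Prod.ext ?_ hw2))
      change a • w.1.1 = 0
      rw [hw1, smul_zero]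
    exact (Submodule.mem_bot R).mp (hle hz')
  have hinj : Function.Injective (π ∘ₗ H.subtype) := fun z w hzw ↦ Subtype.ext <|
    sub_eq_zero.mp <| hzero _ (H.sub_mem z.2 w.2) <| sub_eq_zero.mpr hzw
  have hrange : I ^ (k + s + t) ≤ LinearMap.range (π ∘ₗ H.subtype) := by
    rw [pow_add, Ideal.mul_le]
    intro a ha b hb
    obtain ⟨m, hm⟩ := hc b hb
    let z : G := ⟨(b, m), (hG _).mpr hm⟩
    exact ⟨⟨a • z, Submodule.smul_mem_smul ha trivial⟩, rfl⟩
  let L := LinearEquiv.ofInjective _ hinj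
  refine ⟨k + s + t, LinearMap.snd R R M ∘ₗ G.subtype ∘ₗ H.subtype ∘ₗ L.symm.toLinearMap ∘ₗ
    Submodule.inclusion hrange, fun a ↦ ?_⟩
  have h₁ := (hG _).mp (L.symm (Submodule.inclusion hrange a)).1.2
  refine h₁.trans (congrArg (· • c) ?_)
  exact congrArg Subtype.val (L.apply_symm_apply (Submodule.inclusion hrange a))

lemma exists_forall_eq_smul_of_forall_map_eq (I : Ideal R) (φ : M →ₗ[R] N) {s : ℕ}
    (hker : ∀ a ∈ I ^ s, ∀ m, φ m = 0 → a • m = 0) {t : ℕ} (f : (I ^ t : Ideal R) →ₗ[R] M)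
    {m : M} (hf : ∀ a, φ (f a) = φ ((a : R) • m)) (a : R) (ha : a ∈ I ^ (s + t)) :
    f ⟨a, Ideal.pow_le_pow_right (by lia) ha⟩ = a • m := by
  let g : (I ^ t : Ideal R) →ₗ[R] M :=
    f - LinearMap.toSpanSingleton R M m ∘ₗ Submodule.subtype _
  have hg (b : (I ^ t : Ideal R)) : φ (g b) = 0 := by
    change φ (f b - (b : R) • m) = 0
    rw [map_sub, hf, sub_self]
  have key : I ^ (s + t) ≤ (LinearMap.ker g).map (Submodule.subtype (I ^ t : Ideal R)) := by
    rw [pow_add, Ideal.mul_le]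
    intro a ha b hb
    exact ⟨a • ⟨b, hb⟩, by
      rw [SetLike.mem_coe, LinearMap.mem_ker, map_smul, hker a ha _ (hg _)], rfl⟩
  obtain ⟨b, hb, rfl⟩ := key ha
  exact sub_eq_zero.mp (LinearMap.mem_ker.mp hb)

lemma IsCanonical.exists_forall_eq_smul [IsNoetherianRing R] [IsLocalRing R] {d : ℕ} {ω : Type}
    [AddCommGroup ω] [Module R ω] [Module.Finite R ω] (h : IsCanonical R d ω) (hd : 2 ≤ d)
    {P : Type} [AddCommGroup P] [Module R P] (t : ℕ)
    (f : (maximalIdeal R ^ t : Ideal R) →ₗ[R] P →ₗ[R] ω) :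
    ∃ n : P →ₗ[R] ω, ∀ a, f a = (a : R) • n := by
  obtain ⟨rs, hlen, hrs, -, hreg⟩ := exists_regular_sequence d h.depth fun i hi ↦ h.ext i hi.ne
  obtain _ | ⟨x, _ | ⟨y, rs⟩⟩ := rs
  · simp at hlen; lia
  · simp at hlen; lia
  rw [isWeaklyRegular_cons_iff, isWeaklyRegular_cons_iff] at hreg
  obtain ⟨hx, hy, -⟩ := hreg
  have hxt : x ^ t ∈ maximalIdeal R ^ t := Ideal.pow_mem_pow (hrs x (by simp)) t
  have hyt : y ^ t ∈ maximalIdeal R ^ t := Ideal.pow_mem_pow (hrs y (by simp)) t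
  have hcomm (a b : (maximalIdeal R ^ t : Ideal R)) : (a : R) • f b = (b : R) • f a := by
    rw [← map_smul, ← map_smul]
    exact congrArg f (Subtype.ext (mul_comm _ _))
  obtain ⟨n, hn⟩ := exists_linearMap_eq_smul (hx.pow t) (f ⟨_, hxt⟩) fun p ↦
    exists_eq_smul_of_pow_smul_eq hx hy t t (LinearMap.congr_fun (hcomm ⟨_, hyt⟩ ⟨_, hxt⟩) p)
  refine ⟨n, fun a ↦ (hx.pow t).linearMap ?_⟩
  change x ^ t • f a = x ^ t • (a : R) • n
  rw [smul_comm, ← hn]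
  exact hcomm ⟨_, hxt⟩ a

end ModExt

namespace ModExt

section Colimit

variable {R : Type} [CommRing R]

/-- A compatible family of maps from `Ext^i(R ⧸ I ^ t, M)` that is jointly surjective and whose
kernels die in the colimit identifies the target with local cohomology. -/
lemma nonempty_equiv_localCohomology (I : Ideal R) (M Q : Type) [AddCommGroup M] [Module R M]
    [AddCommGroup Q] [Module R Q] (i : ℕ) (ψ : ∀ t : ℕ, E R (R ⧸ I ^ t) M i →ₗ[R] Q)
    (hcomp : ∀ (t t' : ℕ) (h : t ≤ t') (e : E R (R ⧸ I ^ t) M i),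
      ψ t' (pre (Submodule.mapQ (I ^ t') (I ^ t) LinearMap.id (Ideal.pow_le_pow_right h)) M i e) =
        ψ t e)
    (hsurj : ∀ q, ∃ t e, ψ t e = q)
    (hinj : ∀ t e, ψ t e = 0 → ∃ (t' : ℕ) (h : t ≤ t'),
      pre (Submodule.mapQ (I ^ t') (I ^ t) LinearMap.id (Ideal.pow_le_pow_right h)) M i e = 0) :
    Nonempty (Q ≃ₗ[R] (localCohomology I i).obj (ModuleCat.of R M)) := by
  let D := localCohomology.diagram (localCohomology.idealPowersDiagram I) i
  have := localCohomology.hasColimitDiagram.{0, 0} (localCohomology.idealPowersDiagram I) i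
  let ev := (evaluation (ModuleCat.{0} R) (ModuleCat.{0} R)).obj (ModuleCat.of R M)
  let c := ev.mapCocone (Limits.colimit.cocone D)
  have hc : Limits.IsColimit c := Limits.isColimitOfPreserves ev (Limits.colimit.isColimit D)
  let κ (t : ℕ) : (D ⋙ ev).obj (op (op t)) ≃ₗ[R] E R (R ⧸ I ^ t) M i :=
    extModEquiv R (R ⧸ I ^ t) M i
  have hκ {t t' : ℕ} (w : op (op t) ⟶ op (op t')) (e : (D ⋙ ev).obj (op (op t))) :
      κ t' ((D ⋙ ev).map w e) =
        pre (Submodule.mapQ (I ^ t') (I ^ t) LinearMap.id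
          (Ideal.pow_le_pow_right w.unop.unop.down.down)) M i (κ t e) :=
    extCompare_naturality _ _ _ i e
  let s : Limits.Cocone (D ⋙ ev) :=
    { pt := ModuleCat.of R Q
      ι :=
        { app := fun t ↦ ModuleCat.ofHom (ψ t.unop.unop ∘ₗ (κ t.unop.unop).toLinearMap)
          naturality := fun t t' w ↦ by
            ext e
            exact (congrArg (ψ _) (hκ w e)).trans (hcomp _ _ w.unop.unop.down.down _) } }
  have hs (t : ℕ) (e : (D ⋙ ev).obj (op (op t))) :
      hc.desc s (c.ι.app (op (op t)) e) = ψ t (κ t e) :=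
    congr($(hc.fac s (op (op t))) e)
  have hbij : Function.Bijective (hc.desc s).hom := by
    refine ⟨(injective_iff_map_eq_zero (hc.desc s).hom).mpr fun x hx ↦ ?_, fun q ↦ ?_⟩
    · obtain ⟨⟨⟨t⟩⟩, e, rfl⟩ := Limits.Concrete.isColimit_exists_rep (D ⋙ ev) hc x
      obtain ⟨t', h, h0⟩ := hinj t (κ t e) ((hs t e).symm.trans hx)
      let w : op (op t) ⟶ op (op t') := (homOfLE h).op.op
      have hw : (D ⋙ ev).map w e = 0 := (κ t').injective (by
        rw [hκ w e, map_zero]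
        exact h0)
      have := congr($(c.w w) e)
      exact this.symm.trans ((congrArg (c.ι.app (op (op t'))) hw).trans (map_zero _))
    · obtain ⟨t, e, rfl⟩ := hsurj q
      obtain ⟨e, rfl⟩ := (κ t).surjective e
      exact ⟨_, hs t e⟩
  exact ⟨(LinearEquiv.ofBijective (hc.desc s).hom hbij).symm⟩

end Colimit

variable {R : Type} [CommRing R] [IsNoetherianRing R] [IsLocalRing R]

lemma IsCanonical.nonempty_coker_evMap_equiv {d : ℕ} {ω : Type} [AddCommGroup ω] [Module R ω]
    [Module.Finite R ω] (h : IsCanonical R d ω) (hd : 2 ≤ d) {M : Type} [AddCommGroup M]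
    [Module R M] [Module.Finite R M]
    (hAss : associatedPrimes R M ⊆ associatedPrimes R R ∪ {maximalIdeal R})
    (hS2 : serreS2Punctured R M) :
    Nonempty ((((M →ₗ[R] ω) →ₗ[R] ω) ⧸ LinearMap.range (evMap R M ω)) ≃ₗ[R] lcMod R 1 M) := by
  obtain ⟨x, hxm, hx⟩ := h.exists_isSMulRegular_mem (h.maximalIdeal_notMem (by lia))
  obtain ⟨s, hs⟩ := h.exists_pow_smul_eq_zero_of_evMap_eq_zero hAss
  obtain ⟨t₀, ht₀⟩ := h.exists_pow_smul_mem_range_evMap (by lia) hAss hS2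
  have hinj (t : ℕ) (n : (M →ₗ[R] ω) →ₗ[R] ω) (hn : ∀ a ∈ maximalIdeal R ^ t, a • n = 0) :
      n = 0 :=
    ((h.isSMulRegular hx).linearMap.pow t).right_eq_zero_of_smul (hn _ (Ideal.pow_mem_pow hxm t))
  choose ψ hψ using fun t ↦ exists_ext_one_to_coker (J := maximalIdeal R ^ t) (evMap R M ω)
    (hinj t) (h.exists_forall_eq_smul hd t)
  have hrep (t : ℕ) (e : E R (R ⧸ maximalIdeal R ^ t) M 1) :
      ∃ (f : (maximalIdeal R ^ t : Ideal R) →ₗ[R] M) (n : (M →ₗ[R] ω) →ₗ[R] ω),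
        connecting _ M f = e ∧ ∀ a, evMap R M ω (f a) = (a : R) • n := by
    obtain ⟨f, rfl⟩ := connecting_surjective _ M e
    obtain ⟨n, hn⟩ := h.exists_forall_eq_smul hd t (evMap R M ω ∘ₗ f)
    exact ⟨f, n, rfl, hn⟩
  refine nonempty_equiv_localCohomology _ M _ 1 ψ (fun t t' htt' e ↦ ?_) (fun q ↦ ?_)
    fun t e he ↦ ?_
  · obtain ⟨f, n, rfl, hn⟩ := hrep t e
    rw [pre_connecting, hψ t f n hn, hψ t' _ n fun a ↦ hn _]
  · obtain ⟨c, rfl⟩ := Submodule.mkQ_surjective _ q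
    obtain ⟨t', f, hf⟩ := exists_linearMap_pow_of_smul_mem_range (maximalIdeal R) (evMap R M ω) hs
      fun a ha ↦ ht₀ a ha c
    exact ⟨t', connecting _ M f, hψ t' f c hf⟩
  · obtain ⟨f, n, rfl, hn⟩ := hrep t e
    rw [hψ t f n hn, Submodule.Quotient.mk_eq_zero] at he
    obtain ⟨m, rfl⟩ := he
    refine ⟨s + t, by lia, ?_⟩
    rw [pre_connecting, connecting_eq_zero_iff]
    exact ⟨m, fun a ↦ exists_forall_eq_smul_of_forall_map_eq (maximalIdeal R) (evMap R M ω) hs f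
      (fun a ↦ by rw [hn, map_smul]) a a.2⟩

end ModExt

/-- Over a Cohen-Macaulay Noetherian local ring of dimension `d ≥ 2` with
canonical module `ω`, if `Ass M ⊆ Ass R ∪ {𝔪}` and `M` satisfies `(S₂)` on the punctured
spectrum, then `coker φ ≅ H^1_𝔪(M)` for the evaluation map `φ : M → Hom(Hom(M,ω),ω)`; together
with `ker φ = Γ_𝔪(M)` this yields the exact sequence
`0 → Γ_𝔪(M) → M → M^∨∨ → H^1_𝔪(M) → 0`. -/
theorem statement9 (R : Type) [CommRing R] [IsNoetherianRing R] [IsLocalRing R]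
    (d : ℕ) (hd : 2 ≤ d) (hR : isCMLocalRing R d)
    (ω : Type) [AddCommGroup ω] [Module R ω] (hω : isCanonicalModule R d ω)
    (M : Type) [AddCommGroup M] [Module R M] [Module.Finite R M]
    (hAss : associatedPrimes R M ⊆ associatedPrimes R R ∪ {maximalIdeal R})
    (hS2 : serreS2Punctured R M) :
    Nonempty ((((M →ₗ[R] ω) →ₗ[R] ω) ⧸ LinearMap.range (evMap R M ω)) ≃ₗ[R] (lcMod R 1 M)) ∧
      LinearMap.ker (evMap R M ω) = mTorsion R M := by
  have := hω.1
  have h : ModExt.IsCanonical R d ω :=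
    { dim := hR.1
      depth := fun i hi ↦ ModExt.subsingleton_of_lt_rdepth (by rw [hR.2]; exact_mod_cast hi)
      ext := fun i hi ↦
        have := hω.2.1 i hi
        (extModEquiv R (ResidueField R) ω i).symm.toEquiv.subsingleton
      equiv := hω.2.2.map ((extModEquiv R (ResidueField R) ω d).symm.trans ·) }
  exact ⟨h.nonempty_coker_evMap_equiv hd hAss hS2, h.ker_evMap (by lia) hAss⟩
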